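/- arXiv:2206.06167 — 2 statements merged into one kernel-verified Lean document; each statement's English description precedes it below -/
import Mathlib

section
/- Assume f : 𝒳ⁿ × ℝᵐ → ℝⁿ is Lipschitz on bounded sets with f(0,0) = 0. Suppose there exist ρ of class 𝒦∞, α of class 𝒫, γ of class 𝒩, and a continuously differentiable, positive definite and radially unbounded function V : ℝⁿ → [0,∞) (V(0)=0, V(z)>0 for z≠0, and V(z) → ∞ as |z| → ∞) such that for all φ ∈ 𝒳ⁿ and v ∈ ℝᵐ: if V(φ(0)) ≥ max{ ρ(max_{τ∈[-Δ,0]} V(φ(τ))), γ(|v|) }, then ∇V(φ(0)) · f(φ,v) ≤ −α(|φ(0)|). If ρ(s) < s for all s > 0, then the system ẋ(t) = f(x_t, u(t)) is ISS. -/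
open Set Filter MeasureTheory Topology
open scoped NNReal

noncomputable section

/-- `ℝⁿ` with the Euclidean norm. -/
abbrev Vec (n : ℕ) : Type := EuclideanSpace ℝ (Fin n)

/-- The state space `𝒳ⁿ = C([-Δ,0], ℝⁿ)`, equipped with the sup norm. -/
abbrev Hist (Δ : ℝ≥0) (n : ℕ) : Type :=
  ContinuousMap (Icc (-(Δ : ℝ)) (0 : ℝ)) (Vec n)

theorem zero_mem_IccD (Δ : ℝ≥0) : (0 : ℝ) ∈ Icc (-(Δ : ℝ)) (0 : ℝ) :=
  ⟨neg_nonpos.mpr Δ.coe_nonneg, le_refl 0⟩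

/-- `φ(0)`: the current value of a history segment. -/
def ev0 {Δ : ℝ≥0} {n : ℕ} (φ : Hist Δ n) : Vec n :=
  φ ⟨0, zero_mem_IccD Δ⟩

/-! ### Comparison functions -/

/-- Class `𝒦`: continuous, strictly increasing, zero at zero (on `[0,∞)`). -/
def ClassK (α : ℝ → ℝ) : Prop :=
  ContinuousOn α (Ici 0) ∧ StrictMonoOn α (Ici 0) ∧ α 0 = 0

/-- Class `𝒦∞`: class `𝒦` and unbounded. -/
def ClassKinf (α : ℝ → ℝ) : Prop :=
  ClassK α ∧ Tendsto α atTop atTop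

/-- Class `𝒩`: continuous, nondecreasing, zero at zero (on `[0,∞)`). -/
def ClassN (α : ℝ → ℝ) : Prop :=
  ContinuousOn α (Ici 0) ∧ MonotoneOn α (Ici 0) ∧ α 0 = 0

/-- Class `𝒫`: continuous, zero at zero, positive on `(0,∞)`. -/
def ClassP (α : ℝ → ℝ) : Prop :=
  ContinuousOn α (Ici 0) ∧ α 0 = 0 ∧ ∀ s : ℝ, 0 < s → 0 < α s

/-- Class `𝒦ℒ`. -/
def ClassKL (β : ℝ → ℝ → ℝ) : Prop :=
  (∀ t : ℝ, 0 ≤ t → ClassK fun s => β s t) ∧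
    ∀ s : ℝ, 0 ≤ s →
      ContinuousOn (β s) (Ici 0) ∧ AntitoneOn (β s) (Ici 0) ∧
        Tendsto (β s) atTop (𝓝 0)

/-! ### Inputs -/

/-- Admissible input: Lebesgue measurable and locally essentially bounded. -/
def IsInput {m : ℕ} (u : ℝ → Vec m) : Prop :=
  Measurable u ∧ ∀ T : ℝ, 0 < T → ∃ C : ℝ, ∀ᵐ t ∂volume, t ∈ Icc (0 : ℝ) T → ‖u t‖ ≤ C

/-- Essential supremum of `‖u‖` over a set of times. -/
def essBnd {m : ℕ} (u : ℝ → Vec m) (s : Set ℝ) : ℝ :=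
  sInf {C : ℝ | 0 ≤ C ∧ ∀ᵐ τ ∂volume, τ ∈ s → ‖u τ‖ ≤ C}

/-! ### History segments along a trajectory -/

-- The history segment `x_t ∈ 𝒳ⁿ` of a trajectory `x : ℝ → ℝⁿ` (with junk value `0`
-- when `x` is not continuous on `[t-Δ, t]`).
open Classical in
def seg (Δ : ℝ≥0) {n : ℕ} (x : ℝ → Vec n) (t : ℝ) : Hist Δ n :=
  if hx : ContinuousOn x (Icc (t - (Δ : ℝ)) t) then
    { toFun := fun τ => x (t + τ.1)
      continuous_toFun := by
        have h1 : Continuous fun τ : Icc (-(Δ : ℝ)) (0 : ℝ) => t + τ.1 :=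
          continuous_const.add continuous_subtype_val
        have h2 : ∀ τ : Icc (-(Δ : ℝ)) (0 : ℝ), t + τ.1 ∈ Icc (t - (Δ : ℝ)) t := by
          rintro ⟨τ, hτ⟩
          rw [mem_Icc] at hτ ⊢
          constructor
          · linarith [hτ.1]
          · linarith [hτ.2]
        exact hx.comp_continuous h1 h2 }
  else 0

/-! ### Driver's derivative and Dini derivative -/

/-- The deformed history `φ_{h,w}` appearing in Driver's derivative: for `0 ≤ h < Δ`,
`φ_{h,w}(s) = φ(s+h)` for `s ∈ [-Δ,-h)` and `φ_{h,w}(s) = φ(0) + w(h+s)` for `s ∈ [-h,0]`. -/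
def shiftSeg {Δ : ℝ≥0} {n : ℕ} (φ : Hist Δ n) (w : Vec n) (h : ℝ) : Hist Δ n :=
  { toFun := fun s =>
      φ (projIcc (-(Δ : ℝ)) 0 (neg_nonpos.mpr Δ.coe_nonneg) (s.1 + h)) + max (h + s.1) 0 • w
    continuous_toFun := by
      refine Continuous.add ?_ ?_
      · exact φ.continuous.comp (continuous_projIcc.comp
          (continuous_subtype_val.add continuous_const))
      · exact ((continuous_const.add continuous_subtype_val).max continuous_const).smul
          continuous_const }

/-- Driver's derivative `D⁺V(φ,w)`, valued in the extended reals. -/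
def driverD {Δ : ℝ≥0} {n : ℕ} (V : Hist Δ n → ℝ) (φ : Hist Δ n) (w : Vec n) : EReal :=
  limsup (fun h : ℝ => (((V (shiftSeg φ w h) - V φ) / h : ℝ) : EReal)) (𝓝[>] (0 : ℝ))

/-- Upper right-hand Dini derivative of `ν : ℝ → ℝ`, valued in the extended reals. -/
def diniD (ν : ℝ → ℝ) (t : ℝ) : EReal :=
  limsup (fun h : ℝ => (((ν (t + h) - ν t) / h : ℝ) : EReal)) (𝓝[>] (0 : ℝ))

/-! ### Lipschitz conditions -/

/-- `f : 𝒳ⁿ × ℝᵐ → ℝⁿ` is Lipschitz on bounded sets. -/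
def LipOnBounded {Δ : ℝ≥0} {n m : ℕ} (f : Hist Δ n → Vec m → Vec n) : Prop :=
  ∀ r : ℝ, 0 < r → ∃ L : ℝ, 0 < L ∧
    ∀ (φ₁ φ₂ : Hist Δ n) (v₁ v₂ : Vec m),
      ‖φ₁‖ ≤ r → ‖φ₂‖ ≤ r → ‖v₁‖ ≤ r → ‖v₂‖ ≤ r →
        ‖f φ₁ v₁ - f φ₂ v₂‖ ≤ L * (‖φ₁ - φ₂‖ + ‖v₁ - v₂‖)

/-- An input-free vector field `f₀ : 𝒳ⁿ → ℝⁿ` Lipschitz on bounded sets. -/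
def LipOnBounded₀ {Δ : ℝ≥0} {n : ℕ} (f₀ : Hist Δ n → Vec n) : Prop :=
  ∀ r : ℝ, 0 < r → ∃ L : ℝ, 0 < L ∧
    ∀ φ₁ φ₂ : Hist Δ n, ‖φ₁‖ ≤ r → ‖φ₂‖ ≤ r → ‖f₀ φ₁ - f₀ φ₂‖ ≤ L * ‖φ₁ - φ₂‖

/-- A functional `V : 𝒳ⁿ → ℝ` Lipschitz on bounded sets. -/
def LipOnBoundedV {Δ : ℝ≥0} {n : ℕ} (V : Hist Δ n → ℝ) : Prop :=
  ∀ r : ℝ, 0 < r → ∃ L : ℝ, 0 < L ∧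
    ∀ φ₁ φ₂ : Hist Δ n, ‖φ₁‖ ≤ r → ‖φ₂‖ ≤ r → |V φ₁ - V φ₂| ≤ L * ‖φ₁ - φ₂‖

/-- A functional `V : 𝒳ⁿ → ℝ` locally Lipschitz. -/
def LocallyLipV {Δ : ℝ≥0} {n : ℕ} (V : Hist Δ n → ℝ) : Prop :=
  ∀ φ : Hist Δ n, ∃ δ : ℝ, 0 < δ ∧ ∃ L : ℝ, 0 < L ∧
    ∀ φ₁ φ₂ : Hist Δ n, ‖φ₁ - φ‖ ≤ δ → ‖φ₂ - φ‖ ≤ δ → |V φ₁ - V φ₂| ≤ L * ‖φ₁ - φ₂‖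

/-! ### Solutions -/

/-- `x` is a solution of `ẋ(t) = f(x_t, u(t))` with initial state `x₀` on `[0, tmax)`. -/
structure IsSolution (Δ : ℝ≥0) {n m : ℕ} (f : Hist Δ n → Vec m → Vec n)
    (u : ℝ → Vec m) (x₀ : Hist Δ n) (tmax : EReal) (x : ℝ → Vec n) : Prop where
  tmax_pos : 0 < tmax
  cont : ContinuousOn x {s : ℝ | -(Δ : ℝ) ≤ s ∧ (s : EReal) < tmax}
  init : ∀ τ : Icc (-(Δ : ℝ)) (0 : ℝ), x τ.1 = x₀ τ
  integrable : ∀ t : ℝ, 0 ≤ t → (t : EReal) < tmax →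
    IntervalIntegrable (fun s => f (seg Δ x s) (u s)) volume 0 t
  integral_eq : ∀ t : ℝ, 0 ≤ t → (t : EReal) < tmax →
    x t = x 0 + ∫ s in (0:ℝ)..t, f (seg Δ x s) (u s)

/-- Maximal solution: a solution admitting no proper extension. -/
def IsMaxSolution (Δ : ℝ≥0) {n m : ℕ} (f : Hist Δ n → Vec m → Vec n)
    (u : ℝ → Vec m) (x₀ : Hist Δ n) (tmax : EReal) (x : ℝ → Vec n) : Prop :=
  IsSolution Δ f u x₀ tmax x ∧
    ∀ (tmax' : EReal) (x' : ℝ → Vec n), IsSolution Δ f u x₀ tmax' x' →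
      (∀ t : ℝ, -(Δ : ℝ) ≤ t → (t : EReal) < tmax → x' t = x t) → tmax' ≤ tmax

/-- Solution of the input-free system `ẋ(t) = f₀(x_t)`. -/
def IsSolution₀ (Δ : ℝ≥0) {n : ℕ} (f₀ : Hist Δ n → Vec n) (x₀ : Hist Δ n)
    (tmax : EReal) (x : ℝ → Vec n) : Prop :=
  IsSolution Δ (fun φ (_ : Vec 0) => f₀ φ) (fun _ => 0) x₀ tmax x

/-- Maximal solution of the input-free system `ẋ(t) = f₀(x_t)`. -/
def IsMaxSolution₀ (Δ : ℝ≥0) {n : ℕ} (f₀ : Hist Δ n → Vec n) (x₀ : Hist Δ n)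
    (tmax : EReal) (x : ℝ → Vec n) : Prop :=
  IsMaxSolution Δ (fun φ (_ : Vec 0) => f₀ φ) (fun _ => 0) x₀ tmax x

/-! ### Stability properties (input-free systems) -/

/-- Global asymptotic stability (GAS). -/
def GAS (Δ : ℝ≥0) {n : ℕ} (f₀ : Hist Δ n → Vec n) : Prop :=
  ∃ β : ℝ → ℝ → ℝ, ClassKL β ∧
    ∀ (x₀ : Hist Δ n) (tmax : EReal) (x : ℝ → Vec n),
      IsMaxSolution₀ Δ f₀ x₀ tmax x →
        tmax = ⊤ ∧ ∀ t : ℝ, 0 ≤ t → ‖x t‖ ≤ β ‖x₀‖ t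

/-- Global exponential stability (GES). -/
def GES (Δ : ℝ≥0) {n : ℕ} (f₀ : Hist Δ n → Vec n) : Prop :=
  ∃ k : ℝ, 1 ≤ k ∧ ∃ lam : ℝ, 0 < lam ∧
    ∀ (x₀ : Hist Δ n) (tmax : EReal) (x : ℝ → Vec n),
      IsMaxSolution₀ Δ f₀ x₀ tmax x →
        tmax = ⊤ ∧ ∀ t : ℝ, 0 ≤ t → ‖x t‖ ≤ k * ‖x₀‖ * Real.exp (-lam * t)

/-- (Local) asymptotic stability (AS) of the origin. -/
def AS (Δ : ℝ≥0) {n : ℕ} (f₀ : Hist Δ n → Vec n) : Prop :=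
  ∃ r : ℝ, 0 < r ∧ ∃ β : ℝ → ℝ → ℝ, ClassKL β ∧
    ∀ (x₀ : Hist Δ n) (tmax : EReal) (x : ℝ → Vec n),
      IsMaxSolution₀ Δ f₀ x₀ tmax x → ‖x₀‖ ≤ r →
        tmax = ⊤ ∧ ∀ t : ℝ, 0 ≤ t → ‖x t‖ ≤ β ‖x₀‖ t

/-- (Local) exponential stability (ES) of the origin. -/
def ES (Δ : ℝ≥0) {n : ℕ} (f₀ : Hist Δ n → Vec n) : Prop :=
  ∃ r : ℝ, 0 < r ∧ ∃ k : ℝ, 1 ≤ k ∧ ∃ lam : ℝ, 0 < lam ∧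
    ∀ (x₀ : Hist Δ n) (tmax : EReal) (x : ℝ → Vec n),
      IsMaxSolution₀ Δ f₀ x₀ tmax x → ‖x₀‖ ≤ r →
        tmax = ⊤ ∧ ∀ t : ℝ, 0 ≤ t → ‖x t‖ ≤ k * ‖x₀‖ * Real.exp (-lam * t)

/-! ### Forward completeness -/

/-- Robust forward completeness (RFC) of `ẋ(t) = f(x_t,u(t))`. -/
def RFC (Δ : ℝ≥0) {n m : ℕ} (f : Hist Δ n → Vec m → Vec n) : Prop :=
  (∀ (x₀ : Hist Δ n) (u : ℝ → Vec m) (tmax : EReal) (x : ℝ → Vec n),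
      IsInput u → IsMaxSolution Δ f u x₀ tmax x → tmax = ⊤) ∧
    ∀ T : ℝ, 0 < T → ∀ r : ℝ, 0 < r → ∃ C : ℝ,
      ∀ (x₀ : Hist Δ n) (u : ℝ → Vec m) (tmax : EReal) (x : ℝ → Vec n),
        IsInput u → IsMaxSolution Δ f u x₀ tmax x →
          ‖x₀‖ ≤ r → essBnd u (Ici 0) ≤ r →
            ∀ t : ℝ, t ∈ Icc (0 : ℝ) T → ‖seg Δ x t‖ ≤ C

/-- Robust forward completeness of the input-free system `ẋ(t) = f₀(x_t)`. -/
def RFC₀ (Δ : ℝ≥0) {n : ℕ} (f₀ : Hist Δ n → Vec n) : Prop :=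
  RFC Δ (fun φ (_ : Vec 0) => f₀ φ)

/-! ### Input-to-state stability notions -/

/-- Input-to-state stability (ISS). -/
def ISS (Δ : ℝ≥0) {n m : ℕ} (f : Hist Δ n → Vec m → Vec n) : Prop :=
  ∃ β : ℝ → ℝ → ℝ, ∃ μ : ℝ → ℝ, ClassKL β ∧ ClassN μ ∧
    ∀ (x₀ : Hist Δ n) (u : ℝ → Vec m) (tmax : EReal) (x : ℝ → Vec n),
      IsInput u → IsMaxSolution Δ f u x₀ tmax x →
        tmax = ⊤ ∧ ∀ t : ℝ, 0 ≤ t → ‖x t‖ ≤ β ‖x₀‖ t + μ (essBnd u (Icc 0 t))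

/-- Local input-to-state stability (LISS). -/
def LISS (Δ : ℝ≥0) {n m : ℕ} (f : Hist Δ n → Vec m → Vec n) : Prop :=
  ∃ r : ℝ, 0 < r ∧ ∃ β : ℝ → ℝ → ℝ, ∃ μ : ℝ → ℝ, ClassKL β ∧ ClassN μ ∧
    ∀ (x₀ : Hist Δ n) (u : ℝ → Vec m) (tmax : EReal) (x : ℝ → Vec n),
      IsInput u → IsMaxSolution Δ f u x₀ tmax x →
        ‖x₀‖ ≤ r → essBnd u (Ici 0) ≤ r →
          tmax = ⊤ ∧ ∀ t : ℝ, 0 ≤ t → ‖x t‖ ≤ β ‖x₀‖ t + μ (essBnd u (Icc 0 t))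

/-- Integral input-to-state stability (iISS). -/
def iISS (Δ : ℝ≥0) {n m : ℕ} (f : Hist Δ n → Vec m → Vec n) : Prop :=
  ∃ β : ℝ → ℝ → ℝ, ∃ η μ : ℝ → ℝ, ClassKL β ∧ ClassN η ∧ ClassN μ ∧
    ∀ (x₀ : Hist Δ n) (u : ℝ → Vec m) (tmax : EReal) (x : ℝ → Vec n),
      IsInput u → IsMaxSolution Δ f u x₀ tmax x →
        tmax = ⊤ ∧ ∀ t : ℝ, 0 ≤ t →
          ‖x t‖ ≤ β ‖x₀‖ t + η (∫ s in (0:ℝ)..t, μ ‖u s‖)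

/-- The UBEBS estimate with offset `c`. -/
def UBEBSwith (Δ : ℝ≥0) {n m : ℕ} (f : Hist Δ n → Vec m → Vec n) (c : ℝ) : Prop :=
  ∃ α ξ ζ : ℝ → ℝ, ClassKinf α ∧ ClassKinf ξ ∧ ClassKinf ζ ∧
    ∀ (x₀ : Hist Δ n) (u : ℝ → Vec m) (tmax : EReal) (x : ℝ → Vec n),
      IsInput u → IsMaxSolution Δ f u x₀ tmax x →
        tmax = ⊤ ∧ ∀ t : ℝ, 0 ≤ t →
          α ‖x t‖ ≤ ξ ‖x₀‖ + (∫ s in (0:ℝ)..t, ζ ‖u s‖) + c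

/-! ### Lyapunov–Krasovskii functionals -/

/-- Lyapunov–Krasovskii functional candidate (LKF). -/
def IsLKF {Δ : ℝ≥0} {n : ℕ} (V : Hist Δ n → ℝ) : Prop :=
  (∀ φ, 0 ≤ V φ) ∧ LipOnBoundedV V ∧
    ∃ α₁ α₂ : ℝ → ℝ, ClassKinf α₁ ∧ ClassKinf α₂ ∧
      ∀ φ : Hist Δ n, α₁ ‖ev0 φ‖ ≤ V φ ∧ V φ ≤ α₂ ‖φ‖

/-- Coercive Lyapunov–Krasovskii functional candidate. -/
def IsCoerciveLKF {Δ : ℝ≥0} {n : ℕ} (V : Hist Δ n → ℝ) : Prop :=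
  (∀ φ, 0 ≤ V φ) ∧ LipOnBoundedV V ∧
    ∃ α₁ α₂ : ℝ → ℝ, ClassKinf α₁ ∧ ClassKinf α₂ ∧
      ∀ φ : Hist Δ n, α₁ ‖φ‖ ≤ V φ ∧ V φ ≤ α₂ ‖φ‖

end

theorem exists_classK_majorant {A : Type*} (p q : A → ℝ) (hp : ∀ a, 0 ≤ p a) (hq : ∀ a, 0 ≤ q a)
    (hbdd : ∀ R : ℝ, ∃ C : ℝ, ∀ a, p a ≤ R → q a ≤ C)
    (hzero : ∀ ε > 0, ∃ δ > 0, ∀ a, p a ≤ δ → q a ≤ ε) :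
    ∃ σ : ℝ → ℝ, ClassK σ ∧ ∀ a, q a ≤ σ (p a) := by
  set h : ℝ → ℝ := fun s => sSup (q '' {a | p a ≤ s}) with hh
  have hBdd : ∀ s, BddAbove (q '' {a | p a ≤ s}) := by
    intro s
    obtain ⟨C, hC⟩ := hbdd s
    exact ⟨C, by rintro _ ⟨a, ha, rfl⟩; exact hC a ha⟩
  have hnn : ∀ s, 0 ≤ h s := fun s =>
    Real.sSup_nonneg (by rintro _ ⟨a, -, rfl⟩; exact hq a)
  have hmono : Monotone h := by
    intro s t hst
    refine Real.sSup_le ?_ (hnn t)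
    rintro _ ⟨a, ha, rfl⟩
    exact le_csSup (hBdd t) ⟨a, le_trans ha hst, rfl⟩
  have hle : ∀ a, q a ≤ h (p a) := fun a => le_csSup (hBdd _) ⟨a, le_refl (p a), rfl⟩
  have hsmall : ∀ ε > 0, ∃ δ > 0, ∀ s, s ≤ δ → h s ≤ ε := by
    intro ε hε
    obtain ⟨δ, hδ, H⟩ := hzero ε hε
    refine ⟨δ, hδ, fun s hs => Real.sSup_le ?_ hε.le⟩
    rintro _ ⟨a, ha, rfl⟩
    exact H a (le_trans ha hs)
  have h00 : h 0 = 0 := by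
    refine le_antisymm (le_of_forall_pos_le_add fun ε hε => ?_) (hnn 0)
    obtain ⟨δ, hδ, H⟩ := hsmall ε hε
    simpa using H 0 hδ.le
  have hInt : ∀ a b, IntervalIntegrable h volume a b := fun a b => hmono.intervalIntegrable
  have hInt' : ∀ s, 0 ≤ s → IntervalIntegrable (fun r => h (s * r)) volume 1 2 := fun s hs =>
    Monotone.intervalIntegrable fun a b hab => hmono (mul_le_mul_of_nonneg_left hab hs)
  have hmonoI : ∀ s t, 0 ≤ s → s ≤ t →
      ∫ r in (1:ℝ)..2, h (s * r) ≤ ∫ r in (1:ℝ)..2, h (t * r) := by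
    intro s t hs hst
    refine intervalIntegral.integral_mono_on (by norm_num) (hInt' s hs)
      (hInt' t (hs.trans hst)) fun r hr => hmono ?_
    exact mul_le_mul_of_nonneg_right hst (by linarith [hr.1])
  have hlow : ∀ s, 0 ≤ s → h s ≤ ∫ r in (1:ℝ)..2, h (s * r) := by
    intro s hs
    have : ∫ r in (1:ℝ)..2, h s ≤ ∫ r in (1:ℝ)..2, h (s * r) := by
      refine intervalIntegral.integral_mono_on (by norm_num) (by simp)
        (hInt' s hs) fun r hr => hmono ?_
      nlinarith [hr.1]
    have h1 : ∫ r in (1:ℝ)..2, h s = h s := by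
      rw [intervalIntegral.integral_const, smul_eq_mul]; ring
    linarith
  have hupp : ∀ s, 0 ≤ s → ∫ r in (1:ℝ)..2, h (s * r) ≤ h (s * 2) := by
    intro s hs
    have : ∫ r in (1:ℝ)..2, h (s * r) ≤ ∫ r in (1:ℝ)..2, h (s * 2) := by
      refine intervalIntegral.integral_mono_on (by norm_num) (hInt' s hs)
        (by simp) fun r hr => hmono ?_
      nlinarith [hr.2]
    have h1 : ∫ r in (1:ℝ)..2, h (s * 2) = h (s * 2) := by
      rw [intervalIntegral.integral_const, smul_eq_mul]; ring
    linarith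
  refine ⟨fun s => s + ∫ r in (1:ℝ)..2, h (s * r), ⟨?_, ?_, ?_⟩, ?_⟩
  · intro s hs
    rcases eq_or_lt_of_le (show (0:ℝ) ≤ s from hs) with rfl | hs
    · rw [Metric.continuousWithinAt_iff]
      intro ε hε
      obtain ⟨δ, hδ, H⟩ := hsmall (ε / 3) (by positivity)
      refine ⟨min (δ / 2) (ε / 3), by positivity, fun {s} hs hd => ?_⟩
      have hs : 0 ≤ s := hs
      rw [Real.dist_eq, sub_zero, abs_of_nonneg hs, lt_min_iff] at hd
      have h1 := hupp s hs
      have h2 := H (s * 2) (by linarith)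
      have h3 := hlow s hs
      have h4 := hnn s
      simp only [zero_mul, h00, intervalIntegral.integral_zero, add_zero, Real.dist_eq, sub_zero]
      rw [abs_of_nonneg (by linarith)]
      linarith
    · apply ContinuousAt.continuousWithinAt
      have hc := intervalIntegral.continuous_primitive hInt 0
      have h1 : ContinuousAt (fun s : ℝ => s + s⁻¹ * ((∫ r in (0:ℝ)..(s * 2), h r) -
          ∫ r in (0:ℝ)..s, h r)) s := by
        refine continuousAt_id.add ((continuousAt_inv₀ hs.ne').mul ?_)
        exact ((hc.comp (continuous_mul_const 2)).sub hc).continuousAt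
      refine h1.congr ?_
      filter_upwards [lt_mem_nhds hs] with t ht
      have h2 := intervalIntegral.integral_comp_mul_left (a := 1) (b := 2) h (c := t) ht.ne'
      rw [h2, intervalIntegral.integral_interval_sub_left (hInt _ _) (hInt _ _), mul_one,
        smul_eq_mul]
  · intro s hs t ht hst
    exact add_lt_add_of_lt_of_le hst (hmonoI s t hs hst.le)
  · simp [h00]
  · intro a
    have h1 := hlow (p a) (hp a)
    have h2 := hle a
    have h3 := hp a
    simp only
    linarith

theorem exists_classK_comparison {n : ℕ} {V : Vec n → ℝ} (hV : Continuous V)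
    (hV0 : V 0 = 0) (hVnonneg : ∀ z, 0 ≤ V z) (hVpos : ∀ z : Vec n, z ≠ 0 → 0 < V z)
    (hVrad : ∀ M : ℝ, ∃ R : ℝ, ∀ z : Vec n, R ≤ ‖z‖ → M ≤ V z) :
    ∃ σ lam : ℝ → ℝ, ClassK σ ∧ ClassK lam ∧ (∀ z, V z ≤ σ ‖z‖) ∧ ∀ z, ‖z‖ ≤ lam (V z) := by
  have hrad : ∀ R : ℝ, ∃ C : ℝ, ∀ z, V z ≤ R → ‖z‖ ≤ C := by
    intro R
    obtain ⟨C, hC⟩ := hVrad (R + 1)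
    refine ⟨C, fun z hz => ?_⟩
    by_contra! hlt
    linarith [hC z hlt.le]
  obtain ⟨σ, hσ, hσV⟩ := exists_classK_majorant (fun z : Vec n => ‖z‖) V norm_nonneg hVnonneg
    (by
      intro R
      obtain ⟨C, hC⟩ := (isCompact_closedBall (0 : Vec n) R).bddAbove_image hV.continuousOn
      exact ⟨C, fun z hz => hC ⟨z, by simpa using hz, rfl⟩⟩)
    (by
      intro ε hε
      obtain ⟨δ, hδ, H⟩ := Metric.continuousAt_iff.1 (hV.continuousAt (x := 0)) ε hε
      refine ⟨δ / 2, by positivity, fun z hz => ?_⟩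
      have := H (x := z) (by rw [dist_zero_right]; linarith)
      rw [Real.dist_eq, hV0, sub_zero] at this
      exact (le_abs_self _).trans this.le)
  obtain ⟨lam, hlam, hlamV⟩ := exists_classK_majorant V (fun z : Vec n => ‖z‖) hVnonneg norm_nonneg
    hrad
    (by
      intro ε hε
      obtain ⟨C, hC⟩ := hrad 1
      have hK : IsCompact (Metric.closedBall (0 : Vec n) C ∩ {z | ε ≤ ‖z‖}) :=
        (isCompact_closedBall _ _).inter_right (isClosed_le continuous_const continuous_norm)
      obtain ⟨c, hc, H⟩ := hK.exists_forall_le' hV.continuousOn (a := 0) (by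
        rintro z ⟨-, hz⟩
        exact hVpos z (by rintro rfl; simp at hz; linarith))
      refine ⟨min 1 (c / 2), by positivity, fun z hz => ?_⟩
      by_contra! hlt
      rw [le_min_iff] at hz
      have := H z ⟨by simpa using hC z hz.1, hlt.le⟩
      linarith)
  exact ⟨σ, lam, hσ, hlam, hσV, hlamV⟩

theorem exists_continuous_rate {n : ℕ} {V : Vec n → ℝ} (hV : Continuous V)
    (hV0 : V 0 = 0) (hVrad : ∀ M : ℝ, ∃ R : ℝ, ∀ z : Vec n, R ≤ ‖z‖ → M ≤ V z)
    {ρ α : ℝ → ℝ} (hρK : ClassKinf ρ) (hρ : ∀ s, 0 < s → ρ s < s) (hα : ClassP α)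
    {D : ℝ} (hD : 0 ≤ D) :
    ∃ ℓ : ℝ → ℝ, Continuous ℓ ∧ (∀ z, 1 ≤ ℓ z) ∧
      (∀ x, 0 < V x → V x ≤ ℓ (Real.log (V x)) * α ‖x‖) ∧
      ∀ s z, 0 < s → Real.log (ρ s) ≤ z → z ≤ Real.log s →
        D ≤ ℓ z * (Real.log s - Real.log (ρ s)) := by
  obtain ⟨⟨hρc, hρm, hρ0⟩, hρinf⟩ := hρK
  obtain ⟨hαc, hα0, hαpos⟩ := hα
  have hρpos : ∀ s, 0 < s → 0 < ρ s := fun s hs => hρ0 ▸ hρm (self_mem_Ici) hs.le hs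
  let t : ℝ → Set ℝ := fun z => {c | 1 ≤ c} ∩
    {c | (∀ x, V x = Real.exp z → V x ≤ c * α ‖x‖) ∧
      ∀ s, 0 < s → Real.log (ρ s) ≤ z → z ≤ Real.log s →
        D ≤ c * (Real.log s - Real.log (ρ s))}
  suffices H : (∀ z, Convex ℝ (t z)) ∧ ∀ z, ∃ c : ℝ, ∀ᶠ y in 𝓝 z, c ∈ t y by
    obtain ⟨g, hg⟩ := exists_continuous_forall_mem_convex_of_local_const H.1 H.2
    refine ⟨g, g.continuous, fun z => (hg z).1, fun x hx => ?_, fun s z hs => (hg z).2.2 s hs⟩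
    exact (hg _).2.1 x (Real.exp_log hx).symm
  constructor
  · intro z a ha b hb u v hu hv huv
    refine ⟨convex_Ici (1:ℝ) ha.1 hb.1 hu hv huv, fun x hx => ?_, fun s hs h1 h2 => ?_⟩
    · have h3 := mul_le_mul_of_nonneg_left (ha.2.1 x hx) hu
      have h4 := mul_le_mul_of_nonneg_left (hb.2.1 x hx) hv
      simp only [smul_eq_mul]
      calc V x = u * V x + v * V x := by rw [← add_mul, huv, one_mul]
        _ ≤ _ := by linarith
    · have h3 := mul_le_mul_of_nonneg_left (ha.2.2 s hs h1 h2) hu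
      have h4 := mul_le_mul_of_nonneg_left (hb.2.2 s hs h1 h2) hv
      simp only [smul_eq_mul]
      calc D = u * D + v * D := by rw [← add_mul, huv, one_mul]
        _ ≤ _ := by linarith
  · intro z
    obtain ⟨c₁, hc₁, H₁⟩ : ∃ c > 0, ∀ x, V x ∈ Icc (Real.exp (z - 1)) (Real.exp (z + 1)) →
        c ≤ α ‖x‖ := by
      obtain ⟨R, hR⟩ := hVrad (Real.exp (z + 1) + 1)
      have hK : IsCompact (Metric.closedBall (0 : Vec n) R ∩
          V ⁻¹' Icc (Real.exp (z - 1)) (Real.exp (z + 1))) :=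
        (isCompact_closedBall _ _).inter_right (isClosed_Icc.preimage hV)
      obtain ⟨c, hc, H⟩ := hK.exists_forall_le' (f := fun x => α ‖x‖)
        (hαc.comp continuous_norm.continuousOn fun x _ => norm_nonneg x) (a := 0) (by
          rintro x ⟨-, hx⟩
          refine hαpos _ (norm_pos_iff.2 ?_)
          rintro rfl
          have := Real.exp_pos (z - 1)
          have := hx.1
          linarith)
      refine ⟨c, hc, fun x hx => H x ⟨?_, hx⟩⟩
      rw [mem_closedBall_zero_iff]
      by_contra! hlt
      linarith [hR x hlt.le, hx.2]
    obtain ⟨S, hS⟩ := (hρinf.eventually_gt_atTop (Real.exp (z + 1))).exists_forall_of_atTop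
    obtain ⟨c₂, hc₂, H₂⟩ : ∃ c > 0, ∀ s ∈ Icc (Real.exp (z - 1)) S,
        c ≤ Real.log s - Real.log (ρ s) := by
      refine isCompact_Icc.exists_forall_le' ?_ ?_
      · have hsub : Icc (Real.exp (z - 1)) S ⊆ Ici 0 := fun s hs =>
          (Real.exp_pos _).le.trans hs.1
        have hpos : ∀ s ∈ Icc (Real.exp (z - 1)) S, 0 < s := fun s hs =>
          (Real.exp_pos _).trans_le hs.1
        exact (continuousOn_id.log fun s hs => (hpos s hs).ne').sub
          ((hρc.mono hsub).log fun s hs => (hρpos s (hpos s hs)).ne')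
      · intro s hs
        have hs0 : 0 < s := (Real.exp_pos _).trans_le hs.1
        exact sub_pos.2 (Real.log_lt_log (hρpos s hs0) (hρ s hs0))
    refine ⟨1 + Real.exp (z + 1) / c₁ + D / c₂, ?_⟩
    filter_upwards [Ioo_mem_nhds (sub_one_lt z) (lt_add_one z)] with y hy
    have hE := Real.exp_pos (z + 1)
    refine ⟨?_, fun x hx => ?_, fun s hs h1 h2 => ?_⟩
    · have : 0 ≤ Real.exp (z + 1) / c₁ + D / c₂ := by positivity
      simp only [mem_ofPred_eq]
      linarith
    · have h3 : V x ≤ Real.exp (z + 1) := by rw [hx]; exact Real.exp_le_exp.2 hy.2.le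
      have h4 := H₁ x ⟨by rw [hx]; exact Real.exp_le_exp.2 hy.1.le, h3⟩
      calc V x ≤ Real.exp (z + 1) / c₁ * c₁ := by rwa [div_mul_cancel₀ _ hc₁.ne']
        _ ≤ _ := by
          refine mul_le_mul ?_ h4 hc₁.le (by positivity)
          have : 0 ≤ D / c₂ := by positivity
          linarith
    · have h3 : s ∈ Icc (Real.exp (z - 1)) S := by
        refine ⟨?_, ?_⟩
        · rw [← Real.le_log_iff_exp_le hs]; linarith [hy.1]
        · by_contra! hlt
          have := hS s hlt.le
          rw [← Real.lt_log_iff_exp_lt (hρpos s hs)] at this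
          linarith [hy.2]
      have h4 := H₂ s h3
      calc D ≤ D / c₂ * c₂ := by rw [div_mul_cancel₀ _ hc₂.ne']
        _ ≤ _ := by
          refine mul_le_mul ?_ h4 hc₂.le (by positivity)
          have : 0 ≤ Real.exp (z + 1) / c₁ := by positivity
          linarith

theorem exists_time_scale {ℓ : ℝ → ℝ} (hℓ : Continuous ℓ) (hℓ1 : ∀ z, 1 ≤ ℓ z) :
    ∃ Θ : ℝ ≃o ℝ, (∀ z, HasDerivAt Θ (ℓ z) z) ∧
      ∀ a b c : ℝ, a ≤ b → (∀ z ∈ Icc a b, c ≤ ℓ z * (b - a)) → c ≤ Θ b - Θ a := by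
  set θ : ℝ → ℝ := fun y => ∫ z in (0:ℝ)..y, ℓ z with hθ
  have hInt : ∀ a b, IntervalIntegrable ℓ volume a b := fun a b => hℓ.intervalIntegrable a b
  have hderiv : ∀ z, HasDerivAt θ (ℓ z) z := fun z => hℓ.integral_hasStrictDerivAt 0 z |>.hasDerivAt
  have hdiff : ∀ a b, θ b - θ a = ∫ z in a..b, ℓ z := fun a b =>
    intervalIntegral.integral_interval_sub_left (hInt _ _) (hInt _ _)
  have hgrow : ∀ a b, a ≤ b → b - a ≤ θ b - θ a := by
    intro a b hab
    have := intervalIntegral.integral_mono_on hab (by simp) (hInt a b) fun z _ => hℓ1 z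
    simpa [hdiff] using this
  have hmono : StrictMono θ := fun a b hab => by linarith [hgrow a b hab.le]
  have hcont : Continuous θ := continuous_iff_continuousAt.2 fun z => (hderiv z).continuousAt
  have h0 : θ 0 = 0 := by simp [hθ]
  have hsurj : Function.Surjective θ := by
    refine hcont.surjective ?_ ?_
    · refine tendsto_atTop_mono' _ ?_ tendsto_id
      filter_upwards [eventually_ge_atTop 0] with y hy
      simpa [h0] using hgrow 0 y hy
    · refine tendsto_atBot_mono' _ ?_ tendsto_id
      filter_upwards [eventually_le_atBot 0] with y hy
      have := hgrow y 0 hy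
      simp only [id]
      linarith
  refine ⟨hmono.orderIsoOfSurjective θ hsurj, hderiv, fun a b c hab h => ?_⟩
  change c ≤ θ b - θ a
  rw [hdiff]
  rcases eq_or_lt_of_le hab with rfl | hab'
  · simpa using h a (by simp)
  · have := intervalIntegral.integral_mono_on hab (f := fun _ => c / (b - a)) (by simp)
      (hInt a b) fun z hz => by
        rw [div_le_iff₀ (sub_pos.2 hab')]
        exact h z hz
    rw [intervalIntegral.integral_const, smul_eq_mul,
      mul_div_cancel₀ _ (sub_pos.2 hab').ne'] at this
    exact this

theorem razumikhin_comparison {D T M g : ℝ} {v ρ : ℝ → ℝ} (Θ : ℝ ≃o ℝ) (hD : 0 ≤ D)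
    (hρK : ClassKinf ρ) (hρ : ∀ s, 0 < s → ρ s < s)
    (hΘ : ∀ s, 0 < s → D + 1 ≤ Θ (Real.log s) - Θ (Real.log (ρ s))) (hM : 0 < M)
    (hvc : ContinuousOn v (Icc (-D) T)) (hinit : ∀ t ∈ Icc (-D) 0, v t ≤ M)
    (hdecay : ∀ a b B, 0 ≤ a → a ≤ b → b ≤ T → (∀ t ∈ Icc (a - D) b, v t ≤ B) →
      (∀ t ∈ Icc a b, g ≤ v t ∧ ρ B ≤ v t ∧ 0 < v t) →
      Θ (Real.log (v b)) ≤ Θ (Real.log (v a)) - (b - a)) :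
    ∀ t ∈ Icc 0 T, v t ≤ max (Real.exp (Θ.symm (Θ (Real.log M) - t))) g := by
  obtain ⟨⟨hρc, hρm, hρ0⟩, -⟩ := hρK
  set m : ℝ → ℝ := fun t => Real.exp (Θ.symm (Θ (Real.log M) - max t 0)) with hm
  set w : ℝ → ℝ := fun t => max (m t) g with hw
  have hmpos : ∀ t, 0 < m t := fun t => Real.exp_pos _
  have hwpos : ∀ t, 0 < w t := fun t => (hmpos t).trans_le (le_max_left _ _)
  have hmM : ∀ t, t ≤ 0 → m t = M := fun t ht => by
    simp [hm, max_eq_right ht, Real.exp_log hM]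
  have hΘm : ∀ t, Θ (Real.log (m t)) = Θ (Real.log M) - max t 0 := fun t => by simp [hm]
  have hmc : Continuous m := Real.continuous_exp.comp
    (Θ.symm.continuous.comp (continuous_const.sub (continuous_id.max continuous_const)))
  have hwc : Continuous w := hmc.max continuous_const
  have hmanti : Antitone m := fun s t hst => by
    refine Real.exp_le_exp.2 (Θ.symm.monotone ?_)
    have := max_le_max_right 0 hst
    linarith
  have hwanti : Antitone w := fun s t hst => max_le_max_right g (hmanti hst)
  have hlt : ∀ s t, 0 < s → Θ (Real.log s) < Θ (Real.log (m t)) → s < m t := fun s t hs h => by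
    rwa [Θ.lt_iff_lt, Real.log_lt_log_iff hs (hmpos t)] at h
  have hgap : ∀ t, ρ (w (t - D)) < w t := by
    intro t
    rcases le_total (m (t - D)) g with h | h
    · have hg : 0 < g := (hmpos _).trans_le h
      rw [show w (t - D) = g from max_eq_right h]
      exact (hρ g hg).trans_le (le_max_right _ _)
    · rw [show w (t - D) = m (t - D) from max_eq_left h]
      refine lt_of_lt_of_le (hlt _ _ ?_ ?_) (le_max_left _ _)
      · exact hρ0 ▸ hρm self_mem_Ici (hmpos _).le (hmpos _)
      · have h1 := hΘ _ (hmpos (t - D))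
        rw [hΘm] at h1 ⊢
        have h2 : max t 0 ≤ max (t - D) 0 + D :=
          max_le (by linarith [le_max_left (t - D) 0]) (by linarith [le_max_right (t - D) 0])
        linarith
  suffices H : ∀ t ∈ Icc 0 T, v t ≤ w t by
    intro t ht
    simpa only [hw, hm, max_eq_left ht.1] using H t ht
  by_contra! hbad
  set Bd : Set ℝ := {t | t ∈ Icc 0 T ∧ w t < v t} with hBd
  have hne : Bd.Nonempty := by
    obtain ⟨t, ht, h⟩ := hbad
    exact ⟨t, ht, h⟩
  have hbb : BddBelow Bd := ⟨0, fun t ht => ht.1.1⟩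
  set s := sInf Bd with hs
  have hs0 : 0 ≤ s := le_csInf hne fun t ht => ht.1.1
  have hsT : s ≤ T := by
    obtain ⟨t, ht⟩ := hne
    exact (csInf_le hbb ht).trans ht.1.2
  have hpast : ∀ t ∈ Ico 0 s, v t ≤ w t := fun t ht => by
    by_contra! h
    exact notMem_of_lt_csInf ht.2 hbb ⟨⟨ht.1, ht.2.le.trans hsT⟩, h⟩
  have hvs : v s ≤ w s := by
    rcases eq_or_lt_of_le hs0 with h | h
    · rw [← h]
      refine (hinit 0 ⟨by linarith, le_refl 0⟩).trans ?_
      rw [← hmM 0 le_rfl]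
      exact le_max_left _ _
    · refine ContinuousWithinAt.closure_le (s := Ico 0 s) ?_ ?_ hwc.continuousWithinAt hpast
      · rw [closure_Ico h.ne]; exact ⟨hs0, le_refl _⟩
      · exact (hvc s ⟨by linarith, hsT⟩).mono fun t ht => ⟨by linarith [ht.1], by linarith [ht.2]⟩
  have hhist : ∀ t ∈ Icc (s - D) s, v t ≤ w (s - D) := by
    intro t ht
    refine le_trans ?_ (hwanti ht.1)
    rcases le_or_gt t 0 with h | h
    · refine (hinit t ⟨by linarith [ht.1], h⟩).trans ?_
      rw [← hmM t h]
      exact le_max_left _ _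
    · rcases eq_or_lt_of_le ht.2 with rfl | h'
      · exact hvs
      · exact hpast t ⟨h.le, h'⟩
  obtain ⟨B, hB, hρB⟩ : ∃ B, w (s - D) < B ∧ ρ B < w s := by
    have h1 : ContinuousWithinAt ρ (Ioi (w (s - D))) (w (s - D)) :=
      (hρc _ (hwpos _).le).mono fun r hr => (hwpos _).le.trans (le_of_lt hr)
    have h2 := (h1.eventually_lt_const (hgap s)).and self_mem_nhdsWithin
    obtain ⟨B, h3, h4⟩ := h2.exists
    exact ⟨B, h4, h3⟩
  have hev : ∀ᶠ t in 𝓝[Icc (-D) T] s, v t < B ∧ ρ B < w t := by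
    refine ((hvc s ⟨by linarith, hsT⟩).eventually_lt_const ?_).and
      (hwc.continuousWithinAt.eventually_const_lt hρB)
    exact (hhist s ⟨by linarith, le_refl _⟩).trans_lt hB
  obtain ⟨δ, hδ, hball⟩ := Metric.mem_nhdsWithin_iff.1 hev
  obtain ⟨b, hbBd, hbs⟩ := exists_lt_of_csInf_lt hne (show sInf Bd < s + δ by linarith)
  have hsb : s ≤ b := csInf_le hbb hbBd
  have hnear : ∀ t ∈ Icc s b, v t < B ∧ ρ B < w t := fun t ht =>
    hball ⟨by rw [Metric.mem_ball, Real.dist_eq, abs_of_nonneg] <;> linarith [ht.1, ht.2],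
      by linarith [ht.1], ht.2.trans hbBd.1.2⟩
  have hvcI : ContinuousOn v (Icc s b) := hvc.mono fun t ht =>
    ⟨by linarith [ht.1], ht.2.trans hbBd.1.2⟩
  have hclosed : IsCompact (Icc s b ∩ {t | v t ≤ w t}) := by
    have h1 : IsClosed (Icc s b ∩ (fun t => v t - w t) ⁻¹' Iic 0) :=
      (hvcI.sub hwc.continuousOn).preimage_isClosed_of_isClosed isClosed_Icc isClosed_Iic
    convert! isCompact_Icc.of_isClosed_subset h1 inter_subset_left using 1
    ext t
    simp
  obtain ⟨a, ⟨⟨hsa, hab⟩, hva⟩, hamax⟩ :=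
    hclosed.exists_isGreatest ⟨s, ⟨le_refl s, hsb⟩, hvs⟩
  have hab' : a < b := lt_of_le_of_ne hab fun h => by
    have h1 := hbBd.2
    have h2 : v a ≤ w a := hva
    rw [h] at h2
    linarith
  have hafter : ∀ t ∈ Ioc a b, w t < v t := fun t ht => by
    by_contra! h
    exact absurd (hamax ⟨⟨hsa.trans ht.1.le, ht.2⟩, h⟩) (not_le.2 ht.1)
  have hwa : ∀ t ∈ Icc a b, w t ≤ v t := fun t ht => by
    refine ContinuousWithinAt.closure_le (s := Ioc a b) ?_ hwc.continuousWithinAt ?_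
      fun r hr => (hafter r hr).le
    · rwa [closure_Ioc hab'.ne]
    · exact (hvcI t ⟨hsa.trans ht.1, ht.2⟩).mono fun r hr => ⟨hsa.trans hr.1.le, hr.2⟩
  have hdec := hdecay a b B (hs0.trans hsa) hab hbBd.1.2
    (fun t ht => by
      rcases le_total t s with h | h
      · exact (hhist t ⟨by linarith [ht.1], h⟩).trans hB.le
      · exact (hnear t ⟨h, ht.2⟩).1.le)
    (fun t ht => ⟨(le_max_right _ _).trans (hwa t ht),
      (hnear t ⟨hsa.trans ht.1, ht.2⟩).2.le.trans (hwa t ht), (hwpos t).trans_le (hwa t ht)⟩)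
  have hvapos : 0 < v a := (hwpos a).trans_le (hwa a ⟨le_refl a, hab⟩)
  have hvbpos : 0 < v b := (hwpos b).trans hbBd.2
  rcases le_max_iff.1 (show v a ≤ max (m a) g from hva) with h | h
  · have h1 := Θ.monotone (Real.log_le_log hvapos h)
    rw [hΘm, max_eq_left (hs0.trans hsa)] at h1
    have h2 : Θ (Real.log (v b)) ≤ Θ (Real.log (m b)) := by
      rw [hΘm, max_eq_left hbBd.1.1]
      linarith
    rw [Θ.le_iff_le, Real.log_le_log_iff hvbpos (hmpos b)] at h2
    exact absurd (h2.trans (le_max_left _ _)) (not_le.2 hbBd.2)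
  · have h2 : Θ (Real.log (v b)) ≤ Θ (Real.log (v a)) := by linarith
    rw [Θ.le_iff_le, Real.log_le_log_iff hvbpos hvapos] at h2
    exact absurd ((h2.trans h).trans (le_max_right _ _)) (not_le.2 hbBd.2)

theorem seg_apply {Δ : ℝ≥0} {n : ℕ} {x : ℝ → Vec n} {t : ℝ}
    (hx : ContinuousOn x (Icc (t - (Δ : ℝ)) t)) (τ : Icc (-(Δ : ℝ)) (0 : ℝ)) :
    seg Δ x t τ = x (t + τ.1) := by
  simp [seg, hx]

theorem seg_congr {Δ : ℝ≥0} {n : ℕ} {x y : ℝ → Vec n} {t : ℝ}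
    (h : EqOn x y (Icc (t - (Δ : ℝ)) t)) : seg Δ x t = seg Δ y t := by
  by_cases hx : ContinuousOn x (Icc (t - (Δ : ℝ)) t)
  · ext1 τ
    rw [seg_apply hx, seg_apply (hx.congr h.symm)]
    exact h ⟨by linarith [τ.2.1], by linarith [τ.2.2]⟩
  · have hy : ¬ ContinuousOn y (Icc (t - (Δ : ℝ)) t) := fun hy => hx (hy.congr h)
    simp [seg, hx, hy]

theorem continuous_seg {Δ : ℝ≥0} {n : ℕ} {x : ℝ → Vec n} (hx : Continuous x) :
    Continuous (seg Δ x) := by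
  let F : C(ℝ × Icc (-(Δ : ℝ)) (0 : ℝ), Vec n) :=
    ⟨fun p => x (p.1 + p.2.1), by fun_prop⟩
  convert! F.curry.continuous using 1
  ext1 t
  ext1 τ
  exact seg_apply hx.continuousOn τ

theorem norm_seg_le {Δ : ℝ≥0} {n : ℕ} {x : ℝ → Vec n} {t C : ℝ} (hC : 0 ≤ C)
    (h : ∀ r ∈ Icc (t - (Δ : ℝ)) t, ‖x r‖ ≤ C) : ‖seg Δ x t‖ ≤ C := by
  by_cases hx : ContinuousOn x (Icc (t - (Δ : ℝ)) t)
  · rw [ContinuousMap.norm_le _ hC]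
    intro τ
    rw [seg_apply hx]
    exact h _ ⟨by linarith [τ.2.1], by linarith [τ.2.2]⟩
  · simpa [seg, hx] using hC

theorem norm_seg_sub_seg_le {Δ : ℝ≥0} {n : ℕ} {x y : ℝ → Vec n} {t C : ℝ} (hC : 0 ≤ C)
    (hx : Continuous x) (hy : Continuous y)
    (h : ∀ r ∈ Icc (t - (Δ : ℝ)) t, ‖x r - y r‖ ≤ C) : ‖seg Δ x t - seg Δ y t‖ ≤ C := by
  rw [ContinuousMap.norm_le _ hC]
  intro τ
  rw [ContinuousMap.sub_apply, seg_apply hx.continuousOn, seg_apply hy.continuousOn]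
  exact h _ ⟨by linarith [τ.2.1], by linarith [τ.2.2]⟩

theorem IsInput.ae_norm_le_essBnd {m : ℕ} {u : ℝ → Vec m} (hu : IsInput u) (t : ℝ) :
    0 ≤ essBnd u (Icc 0 t) ∧ ∀ᵐ s ∂volume, s ∈ Icc (0 : ℝ) t → ‖u s‖ ≤ essBnd u (Icc 0 t) := by
  set S := {C : ℝ | 0 ≤ C ∧ ∀ᵐ τ ∂volume, τ ∈ Icc 0 t → ‖u τ‖ ≤ C} with hS
  have hne : S.Nonempty := by
    obtain ⟨C, hC⟩ := hu.2 (max t 1) (by positivity)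
    refine ⟨max C 0, le_max_right _ _, ?_⟩
    filter_upwards [hC] with s hs hst
    exact (hs ⟨hst.1, hst.2.trans (le_max_left _ _)⟩).trans (le_max_left _ _)
  refine ⟨le_csInf hne fun C hC => hC.1, ?_⟩
  have h : ∀ k : ℕ, ∀ᵐ s ∂volume, s ∈ Icc (0 : ℝ) t → ‖u s‖ ≤ sInf S + 1 / ((k : ℝ) + 1) := by
    intro k
    obtain ⟨C, hC, hlt⟩ := exists_lt_of_csInf_lt hne
      (show sInf S < sInf S + 1 / ((k : ℝ) + 1) by
        have : 0 < 1 / ((k : ℝ) + 1) := by positivity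
        linarith)
    filter_upwards [hC.2] with s hs hst
    exact (hs hst).trans hlt.le
  filter_upwards [ae_all_iff.2 h] with s hs hst
  refine le_of_forall_pos_le_add fun ε hε => ?_
  obtain ⟨k, hk⟩ := exists_nat_one_div_lt hε
  exact (hs k hst).trans (add_le_add (le_refl (sInf S)) hk.le)

theorem LipOnBounded.continuous {Δ : ℝ≥0} {n m : ℕ} {f : Hist Δ n → Vec m → Vec n}
    (hf : LipOnBounded f) : Continuous fun p : Hist Δ n × Vec m => f p.1 p.2 := by
  rw [continuous_iff_continuousAt]
  intro p
  obtain ⟨L, hL, H⟩ := hf (‖p‖ + 1) (by positivity)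
  have hp1 := norm_fst_le p
  have hp2 := norm_snd_le p
  refine tendsto_iff_norm_sub_tendsto_zero.2 ?_
  refine squeeze_zero' (g := fun q : Hist Δ n × Vec m => L * (‖q.1 - p.1‖ + ‖q.2 - p.2‖))
    (Eventually.of_forall fun q => norm_nonneg _) ?_ ?_
  · filter_upwards [Metric.ball_mem_nhds p one_pos] with q hq
    have h1 : ‖q‖ ≤ ‖p‖ + 1 := by
      rw [Metric.mem_ball, dist_eq_norm] at hq
      linarith [norm_le_norm_add_norm_sub' q p]
    exact H _ _ _ _ ((norm_fst_le q).trans h1) (by linarith) ((norm_snd_le q).trans h1)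
      (by linarith)
  · have : Continuous fun q : Hist Δ n × Vec m => L * (‖q.1 - p.1‖ + ‖q.2 - p.2‖) := by fun_prop
    simpa using this.tendsto p

theorem LipOnBounded.norm_le {Δ : ℝ≥0} {n m : ℕ} {f : Hist Δ n → Vec m → Vec n}
    (hf : LipOnBounded f) (hf0 : f 0 0 = 0) (C : ℝ) :
    ∃ K, 0 ≤ K ∧ ∀ φ v, ‖φ‖ ≤ C → ‖v‖ ≤ C → ‖f φ v‖ ≤ K := by
  obtain ⟨L, hL, H⟩ := hf (max C 1) (by positivity)
  refine ⟨L * (max C 1 + max C 1), by positivity, fun φ v hφ hv => ?_⟩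
  have h1 := hφ.trans (le_max_left C 1)
  have h2 := hv.trans (le_max_left C 1)
  have := H φ 0 v 0 h1 (by simp) h2 (by simp)
  rw [hf0, sub_zero, sub_zero, sub_zero] at this
  exact this.trans (by gcongr)

theorem LipOnBounded.stronglyMeasurable_field {Δ : ℝ≥0} {n m : ℕ} {f : Hist Δ n → Vec m → Vec n}
    (hf : LipOnBounded f) {u : ℝ → Vec m} (hu : IsInput u) {x : ℝ → Vec n} (hx : Continuous x) :
    StronglyMeasurable fun s => f (seg Δ x s) (u s) :=
  hf.continuous.comp_stronglyMeasurable
    ((continuous_seg hx).stronglyMeasurable.prodMk hu.1.stronglyMeasurable)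

theorem LipOnBounded.exists_field_bound {Δ : ℝ≥0} {n m : ℕ} {f : Hist Δ n → Vec m → Vec n}
    (hf : LipOnBounded f) (hf0 : f 0 0 = 0) {u : ℝ → Vec m} (hu : IsInput u) {x : ℝ → Vec n}
    {T C : ℝ} (hx : ∀ t ∈ Ico (-(Δ : ℝ)) T, ‖x t‖ ≤ C) :
    ∃ K, 0 ≤ K ∧ ∀ᵐ s ∂volume, s ∈ Ico (0 : ℝ) T → ‖f (seg Δ x s) (u s)‖ ≤ K := by
  obtain ⟨hU, hub⟩ := hu.ae_norm_le_essBnd T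
  obtain ⟨K, hK, H⟩ := hf.norm_le hf0 (max (max C 0) (essBnd u (Icc 0 T)))
  refine ⟨K, hK, ?_⟩
  filter_upwards [hub] with s hs hsT
  refine H _ _ ?_ ((hs ⟨hsT.1, hsT.2.le⟩).trans (le_max_right _ _))
  refine (norm_seg_le (le_max_right C 0) fun r hr => ?_).trans (le_max_left _ _)
  exact (hx r ⟨by linarith [hr.1, hsT.1], hr.2.trans_lt hsT.2⟩).trans (le_max_left _ _)

theorem IsSolution.sub_eq_integral {Δ : ℝ≥0} {n m : ℕ} {f : Hist Δ n → Vec m → Vec n}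
    {u : ℝ → Vec m} {x₀ : Hist Δ n} {tmax : EReal} {x : ℝ → Vec n}
    (hx : IsSolution Δ f u x₀ tmax x) {a b : ℝ} (ha : 0 ≤ a) (hat : (a : EReal) < tmax)
    (hb : 0 ≤ b) (hbt : (b : EReal) < tmax) :
    x b - x a = ∫ s in a..b, f (seg Δ x s) (u s) := by
  rw [hx.integral_eq a ha hat, hx.integral_eq b hb hbt, add_sub_add_left_eq_sub]
  exact intervalIntegral.integral_interval_sub_left (hx.integrable b hb hbt)
    (hx.integrable a ha hat)

theorem IsSolution.coe_lt_of_le {b : ℝ} {tmax : EReal} (hb : (b : EReal) < tmax) {t : ℝ}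
    (ht : t ≤ b) : (t : EReal) < tmax :=
  (EReal.coe_le_coe_iff.2 ht).trans_lt hb

theorem IsSolution.exists_lipschitzOnWith {Δ : ℝ≥0} {n m : ℕ} {f : Hist Δ n → Vec m → Vec n}
    (hf : LipOnBounded f) (hf0 : f 0 0 = 0) {u : ℝ → Vec m} (hu : IsInput u) {x₀ : Hist Δ n}
    {tmax : EReal} {x : ℝ → Vec n} (hx : IsSolution Δ f u x₀ tmax x) {T C : ℝ}
    (hT : ∀ t < T, (t : EReal) < tmax) (hC : ∀ t ∈ Ico (-(Δ : ℝ)) T, ‖x t‖ ≤ C) :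
    ∃ K : ℝ≥0, LipschitzOnWith K x (Ico 0 T) := by
  obtain ⟨K, hK, H⟩ := hf.exists_field_bound hf0 hu hC
  refine ⟨⟨K, hK⟩, LipschitzOnWith.of_dist_le_mul fun a ha b hb => ?_⟩
  rw [dist_eq_norm, hx.sub_eq_integral hb.1 (hT b hb.2) ha.1 (hT a ha.2), Real.dist_eq]
  refine intervalIntegral.norm_integral_le_of_norm_le_const_ae ?_
  filter_upwards [H] with s hs hsab
  have h1 := uIoc_subset_uIcc hsab
  rw [uIcc, mem_Icc] at h1
  exact hs ⟨(le_min hb.1 ha.1).trans h1.1, h1.2.trans_lt (max_lt hb.2 ha.2)⟩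

theorem IsSolution.ae_hasDerivAt {Δ : ℝ≥0} {n m : ℕ} {f : Hist Δ n → Vec m → Vec n}
    {u : ℝ → Vec m} {x₀ : Hist Δ n} {tmax : EReal} {x : ℝ → Vec n}
    (hx : IsSolution Δ f u x₀ tmax x) {b : ℝ} (hb : (b : EReal) < tmax) :
    ∀ᵐ t ∂volume, t ∈ Ioo 0 b → HasDerivAt x (f (seg Δ x t) (u t)) t := by
  rcases le_or_gt b 0 with h | h
  · simp [Ioo_eq_empty (not_lt.2 h)]
  filter_upwards [(hx.integrable b h.le hb).ae_hasDerivAt_integral] with t ht htb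
  have htI : t ∈ uIcc 0 b := by rw [uIcc_of_le h.le]; exact Ioo_subset_Icc_self htb
  refine ((ht htI 0 left_mem_uIcc).const_add (x 0)).congr_of_eventuallyEq ?_
  filter_upwards [Ioo_mem_nhds htb.1 htb.2] with s hs
  exact hx.integral_eq s hs.1.le (IsSolution.coe_lt_of_le hb hs.2.le)

theorem IsSolution.exists_norm_le {Δ : ℝ≥0} {n m : ℕ} {f : Hist Δ n → Vec m → Vec n}
    {u : ℝ → Vec m} {x₀ : Hist Δ n} {tmax : EReal} {x : ℝ → Vec n}
    (hx : IsSolution Δ f u x₀ tmax x) {b : ℝ} (hb : (b : EReal) < tmax) :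
    ∃ C, ∀ t ∈ Icc (-(Δ : ℝ)) b, ‖x t‖ ≤ C :=
  isCompact_Icc.exists_bound_of_continuousOn
    (hx.cont.mono fun _ ht => ⟨ht.1, IsSolution.coe_lt_of_le hb ht.2⟩)

theorem IsSolution.time_scale_decay {Δ : ℝ≥0} {n m : ℕ} {f : Hist Δ n → Vec m → Vec n}
    (hf : LipOnBounded f) (hf0 : f 0 0 = 0) {u : ℝ → Vec m} (hu : IsInput u) {x₀ : Hist Δ n}
    {tmax : EReal} {x : ℝ → Vec n} (hx : IsSolution Δ f u x₀ tmax x)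
    {V : Vec n → ℝ} (hV : ContDiff ℝ 1 V) {Θ ℓ : ℝ → ℝ} (hℓ : Continuous ℓ)
    (hΘ : ∀ z, HasDerivAt Θ (ℓ z) z) {a b : ℝ} (ha : 0 ≤ a) (hab : a ≤ b)
    (hb : (b : EReal) < tmax) (hpos : ∀ t ∈ Icc a b, 0 < V (x t))
    (hdec : ∀ᵐ t ∂volume, t ∈ Icc a b →
      ℓ (Real.log (V (x t))) * fderiv ℝ V (x t) (f (seg Δ x t) (u t)) ≤ -V (x t)) :
    Θ (Real.log (V (x b))) ≤ Θ (Real.log (V (x a))) - (b - a) := by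
  have hΘ1 : ContDiff ℝ 1 Θ := by
    rw [contDiff_one_iff_deriv]
    refine ⟨fun z => (hΘ z).differentiableAt, ?_⟩
    rwa [show deriv Θ = ℓ from funext fun z => (hΘ z).deriv]
  have hxI : ContinuousOn x (Icc a b) := hx.cont.mono fun t ht =>
    ⟨by linarith [ht.1, Δ.coe_nonneg], IsSolution.coe_lt_of_le hb ht.2⟩
  obtain ⟨K, hK⟩ : ∃ K : ℝ≥0, LipschitzOnWith K x (Icc a b) := by
    obtain ⟨b', hbb', hb'⟩ := EReal.lt_iff_exists_real_btwn.1 hb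
    rw [EReal.coe_lt_coe_iff] at hbb'
    obtain ⟨C, hC⟩ := hx.exists_norm_le hb'
    obtain ⟨K, hK⟩ := hx.exists_lipschitzOnWith hf hf0 hu (T := b')
      (fun t ht => IsSolution.coe_lt_of_le hb' ht.le) fun t ht => hC t ⟨ht.1, ht.2.le⟩
    exact ⟨K, hK.mono fun t ht => ⟨ha.trans ht.1, ht.2.trans_lt hbb'⟩⟩
  set G : Vec n → ℝ := fun z => Θ (Real.log (V z)) with hG
  obtain ⟨K', hK'⟩ : ∃ K' : ℝ≥0, LipschitzOnWith K' G (x '' Icc a b) := by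
    refine LocallyLipschitzOn.exists_lipschitzOnWith_of_compact
      (isCompact_Icc.image_of_continuousOn hxI) ?_
    rintro _ ⟨t, ht, rfl⟩
    have h1 : ContDiffAt ℝ 1 G (x t) :=
      hΘ1.contDiffAt.comp _ (hV.contDiffAt.log (hpos t ht).ne')
    obtain ⟨K', s, hs, hK'⟩ := h1.exists_lipschitzOnWith
    exact ⟨K', s, mem_nhdsWithin_of_mem_nhds hs, hK'⟩
  have hac : AbsolutelyContinuousOnInterval (G ∘ x) a b := by
    apply LipschitzOnWith.absolutelyContinuousOnInterval (K := K' * K)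
    rw [uIcc_of_le hab]
    exact hK'.comp hK (mapsTo_image _ _)
  have hle : ∫ t in a..b, deriv (G ∘ x) t ≤ ∫ t in a..b, (-1 : ℝ) := by
    refine intervalIntegral.integral_mono_ae_restrict hab hac.intervalIntegrable_deriv (by simp) ?_
    rw [EventuallyLE, ae_restrict_iff' measurableSet_Icc]
    have h0 : ∀ᵐ t : ℝ ∂volume, t ≠ a ∧ t ≠ b := by
      rw [eventually_and]
      exact ⟨by simp [ae_iff, measure_singleton], by simp [ae_iff, measure_singleton]⟩
    filter_upwards [h0, hx.ae_hasDerivAt hb, hdec] with t htne htd htdec ht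
    have htb : t ∈ Ioo 0 b :=
      ⟨ha.trans_lt (lt_of_le_of_ne ht.1 htne.1.symm), lt_of_le_of_ne ht.2 htne.2⟩
    have h1 : HasDerivAt (fun s => V (x s)) (fderiv ℝ V (x t) (f (seg Δ x t) (u t))) t :=
      ((hV.differentiable one_ne_zero (x t)).hasFDerivAt).comp_hasDerivAt t (htd htb)
    have h2 : HasDerivAt (G ∘ x) _ t := (hΘ _).comp t (h1.log (hpos t ht).ne')
    rw [h2.deriv, ← mul_div_assoc, div_le_iff₀ (hpos t ht)]
    linarith [htdec ht]
  rw [hac.integral_deriv_eq_sub, intervalIntegral.integral_const] at hle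
  simp only [Function.comp, hG, smul_eq_mul] at hle
  linarith

theorem LipOnBounded.intervalIntegrable_field {Δ : ℝ≥0} {n m : ℕ} {f : Hist Δ n → Vec m → Vec n}
    (hf : LipOnBounded f) (hf0 : f 0 0 = 0) {u : ℝ → Vec m} (hu : IsInput u) {x : ℝ → Vec n}
    (hx : Continuous x) {a b : ℝ} (ha : 0 ≤ a) (hb : 0 ≤ b) :
    IntervalIntegrable (fun s => f (seg Δ x s) (u s)) volume a b := by
  obtain ⟨C, hC⟩ := (isCompact_Icc (a := -(Δ : ℝ)) (b := max a b + 1)).exists_bound_of_continuousOn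
    hx.continuousOn
  obtain ⟨K, -, hK⟩ := hf.exists_field_bound hf0 hu (T := max a b + 1)
    fun t ht => hC t ⟨ht.1, ht.2.le⟩
  refine (intervalIntegrable_const (c := K)).mono_fun
    (hf.stronglyMeasurable_field hu hx).aestronglyMeasurable ?_
  rw [EventuallyLE, ae_restrict_iff' measurableSet_uIoc]
  filter_upwards [hK] with s hs hsab
  have h1 := uIoc_subset_uIcc hsab
  rw [uIcc, mem_Icc] at h1
  exact (hs ⟨(le_min ha hb).trans h1.1, by linarith [h1.2]⟩).trans (le_abs_self K)

theorem LipOnBounded.exists_local_continuation {Δ : ℝ≥0} {n m : ℕ}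
    {f : Hist Δ n → Vec m → Vec n} (hf : LipOnBounded f) (hf0 : f 0 0 = 0) {u : ℝ → Vec m}
    (hu : IsInput u) {ψ : ℝ → Vec n} (hψ : Continuous ψ) {T : ℝ} (hT : 0 ≤ T) :
    ∃ δ > 0, ∃ x : ℝ → Vec n, Continuous x ∧ (∀ t ≤ T, x t = ψ t) ∧
      ∀ t ∈ Icc T (T + δ), x t = ψ T + ∫ s in T..t, f (seg Δ x s) (u s) := by
  obtain ⟨C, hC⟩ := (isCompact_Icc (a := -(Δ : ℝ)) (b := T)).exists_bound_of_continuousOn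
    hψ.continuousOn
  obtain ⟨-, hub⟩ := hu.ae_norm_le_essBnd (T + 1)
  set R := max (max C 0 + 2) (essBnd u (Icc 0 (T + 1))) with hR
  have hR0 : 0 < R := by positivity
  obtain ⟨L, hL, hLip⟩ := hf R hR0
  have hgrow : ∀ φ v, ‖φ‖ ≤ R → ‖v‖ ≤ R → ‖f φ v‖ ≤ L * (R + R) := fun φ v hφ hv => by
    have := hLip φ 0 v 0 hφ (by simpa using hR0.le) hv (by simpa using hR0.le)
    rw [hf0, sub_zero, sub_zero, sub_zero] at this
    exact this.trans (by gcongr)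
  set δ := min 1 (min (1 / (L * (R + R))) (1 / (4 * L))) with hδ
  have hδ0 : 0 < δ := by positivity
  have hδ1 : δ ≤ 1 := min_le_left _ _
  have hδ2 : L * (R + R) * δ ≤ 1 := by
    have : δ ≤ 1 / (L * (R + R)) := (min_le_right _ _).trans (min_le_left _ _)
    rw [le_div_iff₀ (by positivity)] at this
    linarith
  have hδ3 : L * 2 * δ ≤ 1 / 2 := by
    have : δ ≤ 1 / (4 * L) := (min_le_right _ _).trans (min_le_right _ _)
    rw [le_div_iff₀ (by positivity)] at this
    linarith
  have hTδ : T ≤ T + δ := by linarith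
  let I := Icc T (T + δ)
  let tT : I := ⟨T, left_mem_Icc.2 hTδ⟩
  let P : C(I, Vec n) → ℝ → Vec n := fun w t => ψ (min t T) + (w (projIcc T (T + δ) hTδ t) - w tT)
  have hPc : ∀ w, Continuous (P w) := fun w =>
    (hψ.comp (continuous_id.min continuous_const)).add
      ((w.continuous.comp continuous_projIcc).sub continuous_const)
  have hP_le : ∀ w, ∀ t ≤ T, P w t = ψ t := fun w t ht => by
    simp [P, min_eq_left ht, projIcc_of_le_left hTδ ht, tT]
  have hP_norm : ∀ w, ‖w‖ ≤ 1 → ∀ t, 0 ≤ t → ‖seg Δ (P w) t‖ ≤ R := fun w hw t ht => by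
    refine (norm_seg_le (C := max C 0 + 2) (by positivity) fun r hr => ?_).trans (le_max_left _ _)
    have h1 : ‖ψ (min r T)‖ ≤ max C 0 := by
      refine (hC _ ⟨le_min (by linarith [hr.1]) ?_, min_le_right _ _⟩).trans (le_max_left _ _)
      linarith [Δ.coe_nonneg]
    have h2 := (w.norm_coe_le_norm (projIcc T (T + δ) hTδ r)).trans hw
    have h3 := (w.norm_coe_le_norm tT).trans hw
    calc ‖P w r‖ ≤ ‖ψ (min r T)‖ + (‖w (projIcc T (T + δ) hTδ r)‖ + ‖w tT‖) :=
          (norm_add_le _ _).trans (by gcongr; exact norm_sub_le _ _)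
      _ ≤ _ := by linarith
  have hP_sub : ∀ w w' t, ‖seg Δ (P w) t - seg Δ (P w') t‖ ≤ 2 * ‖w - w'‖ := fun w w' t => by
    refine norm_seg_sub_seg_le (by positivity) (hPc w) (hPc w') fun r _ => ?_
    have h2 := (w - w').norm_coe_le_norm (projIcc T (T + δ) hTδ r)
    have h3 := (w - w').norm_coe_le_norm tT
    have h4 : P w r - P w' r = (w - w') (projIcc T (T + δ) hTδ r) - (w - w') tT := by
      simp only [P, ContinuousMap.sub_apply]
      abel
    rw [h4]
    linarith [norm_sub_le ((w - w') (projIcc T (T + δ) hTδ r)) ((w - w') tT)]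
  have hInt : ∀ w, ∀ t ∈ I, IntervalIntegrable (fun s => f (seg Δ (P w) s) (u s)) volume T t :=
    fun w t ht => hf.intervalIntegrable_field hf0 hu (hPc w) hT (hT.trans ht.1)
  let Γ : C(I, Vec n) → C(I, Vec n) := fun w =>
    ⟨fun t => ∫ s in T..t, f (seg Δ (P w) s) (u s), by
      have h1 := intervalIntegral.continuousOn_primitive_interval'
        (hInt w (T + δ) (right_mem_Icc.2 hTδ)) left_mem_uIcc
      rw [uIcc_of_le hTδ] at h1
      exact continuousOn_iff_continuous_domRestrict.1 h1⟩
  have hbound : ∀ (g : ℝ → Vec n) (c : ℝ) (t : I), 0 ≤ c →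
      (∀ s ∈ Icc 0 (T + 1), ‖u s‖ ≤ essBnd u (Icc 0 (T + 1)) → ‖g s‖ ≤ c) →
      ‖∫ s in T..t, g s‖ ≤ c * δ := by
    intro g c t hc hg
    refine (intervalIntegral.norm_integral_le_of_norm_le_const_ae (C := c) ?_).trans ?_
    · filter_upwards [hub] with s hs hst
      rw [uIoc_of_le t.2.1] at hst
      have h1 : s ∈ Icc 0 (T + 1) := ⟨hT.trans hst.1.le, by linarith [hst.2, t.2.2]⟩
      exact hg s h1 (hs h1)
    · rw [abs_of_nonneg (by linarith [t.2.1])]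
      exact mul_le_mul_of_nonneg_left (by linarith [t.2.2]) hc
  have hmaps : MapsTo Γ (Metric.closedBall 0 1) (Metric.closedBall 0 1) := by
    intro w hw
    rw [mem_closedBall_zero_iff] at hw ⊢
    rw [ContinuousMap.norm_le _ zero_le_one]
    intro t
    refine (hbound _ (L * (R + R)) t (by positivity) fun s hs hus => ?_).trans hδ2
    exact hgrow _ _ (hP_norm w hw s hs.1) (hus.trans (le_max_right _ _))
  have hcontr : ContractingWith (1 / 2) (hmaps.restrict Γ _ _) := by
    refine ⟨by rw [← NNReal.coe_lt_coe]; norm_num, LipschitzWith.of_dist_le_mul ?_⟩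
    rintro ⟨w, hw⟩ ⟨w', hw'⟩
    rw [mem_closedBall_zero_iff] at hw hw'
    rw [Subtype.dist_eq, Subtype.dist_eq, dist_eq_norm, dist_eq_norm]
    simp only [MapsTo.val_restrict_apply]
    rw [ContinuousMap.norm_le _ (by positivity)]
    intro t
    rw [ContinuousMap.sub_apply]
    change ‖(∫ s in T..t, f (seg Δ (P w) s) (u s)) - ∫ s in T..t, f (seg Δ (P w') s) (u s)‖ ≤ _
    rw [← intervalIntegral.integral_sub (hInt w t t.2) (hInt w' t t.2)]
    refine (hbound _ (L * (2 * ‖w - w'‖)) t (by positivity) fun s hs hus => ?_).trans ?_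
    · have h1 := hus.trans (le_max_right (max C 0 + 2) _)
      refine (hLip _ _ _ _ (hP_norm w hw s hs.1) (hP_norm w' hw' s hs.1) h1 h1).trans ?_
      rw [sub_self, norm_zero, add_zero]
      exact mul_le_mul_of_nonneg_left (hP_sub w w' s) hL.le
    · have := mul_le_mul_of_nonneg_right hδ3 (norm_nonneg (w - w'))
      push_cast
      linarith
  obtain ⟨w, -, hfix, -⟩ := ContractingWith.exists_fixedPoint'
    Metric.isClosed_closedBall.isComplete hmaps hcontr (x := 0)
    (Metric.mem_closedBall_self zero_le_one) (edist_ne_top _ _)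
  have hw : ∀ t : I, w t = ∫ s in T..t, f (seg Δ (P w) s) (u s) := fun t =>
    (DFunLike.congr_fun hfix t).symm
  refine ⟨δ, hδ0, P w, hPc w, hP_le w, fun t ht => ?_⟩
  have h1 : P w t = ψ T + (w ⟨t, ht⟩ - w tT) := by
    simp only [P, min_eq_right ht.1, projIcc_of_mem hTδ ht]
  rw [h1, hw, hw tT]
  simp [tT]

theorem IsSolution.exists_extension {Δ : ℝ≥0} {n m : ℕ} {f : Hist Δ n → Vec m → Vec n}
    (hf : LipOnBounded f) (hf0 : f 0 0 = 0) {u : ℝ → Vec m} (hu : IsInput u) {x₀ : Hist Δ n}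
    {T C : ℝ} {x : ℝ → Vec n} (hx : IsSolution Δ f u x₀ (T : EReal) x)
    (hC : ∀ t ∈ Ico (-(Δ : ℝ)) T, ‖x t‖ ≤ C) :
    ∃ T' > T, ∃ x' : ℝ → Vec n, IsSolution Δ f u x₀ (T' : EReal) x' ∧
      ∀ t : ℝ, -(Δ : ℝ) ≤ t → (t : EReal) < T → x' t = x t := by
  have hT0 : 0 < T := by exact_mod_cast hx.tmax_pos
  obtain ⟨K, hK⟩ := hx.exists_lipschitzOnWith hf hf0 hu
    (fun t ht => EReal.coe_lt_coe_iff.2 ht) hC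
  obtain ⟨g, hg, hgx⟩ := hK.extend_finite_dimension
  have hΔ : -(Δ : ℝ) ≤ 0 := neg_nonpos.2 Δ.coe_nonneg
  set ψ : ℝ → Vec n := fun t => x₀ (projIcc (-(Δ : ℝ)) 0 hΔ t) + (g (max t 0) - g 0) with hψ
  have hψc : Continuous ψ := (x₀.continuous.comp continuous_projIcc).add
    ((hg.continuous.comp (continuous_id.max continuous_const)).sub continuous_const)
  have hψx : ∀ t ∈ Ico (-(Δ : ℝ)) T, ψ t = x t := by
    intro t ht
    rcases le_total t 0 with h | h
    · simp only [hψ, max_eq_right h, sub_self, add_zero]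
      rw [← hx.init, projIcc_of_mem hΔ ⟨ht.1, h⟩]
    · simp only [hψ, max_eq_left h]
      rw [← hx.init, projIcc_of_right_le hΔ h, ← hgx ⟨h, ht.2⟩, ← hgx ⟨le_refl 0, hT0⟩]
      abel
  obtain ⟨δ, hδ, X, hXc, hXψ, hX⟩ := hf.exists_local_continuation hf0 hu hψc hT0.le
  have hXx : ∀ t ∈ Ico (-(Δ : ℝ)) T, X t = x t := fun t ht => by
    rw [hXψ t ht.2.le, hψx t ht]
  have hInt : ∀ a b, 0 ≤ a → 0 ≤ b →
      IntervalIntegrable (fun s => f (seg Δ X s) (u s)) volume a b :=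
    fun a b ha hb => hf.intervalIntegrable_field hf0 hu hXc ha hb
  have hbefore : ∀ t ∈ Ico 0 T, X t = X 0 + ∫ s in (0 : ℝ)..t, f (seg Δ X s) (u s) := by
    intro t ht
    rw [hXx t ⟨by linarith [ht.1], ht.2⟩, hXx 0 ⟨hΔ, hT0⟩,
      hx.integral_eq t ht.1 (EReal.coe_lt_coe_iff.2 ht.2)]
    congr 1
    refine intervalIntegral.integral_congr fun s hs => ?_
    rw [uIcc_of_le ht.1] at hs
    rw [seg_congr (x := x) (y := X) fun r hr => (hXx r
      ⟨by linarith [hr.1, hs.1], (hr.2.trans hs.2).trans_lt ht.2⟩).symm]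
  have hatT : X T = X 0 + ∫ s in (0 : ℝ)..T, f (seg Δ X s) (u s) := by
    have h1 := intervalIntegral.continuousOn_primitive_interval'
      (hInt 0 T le_rfl hT0.le) left_mem_uIcc
    rw [uIcc_of_le hT0.le] at h1
    exact EqOn.of_subset_closure hbefore hXc.continuousOn (continuousOn_const.add h1)
      Ico_subset_Icc_self (closure_Ico hT0.ne).ge (right_mem_Icc.2 hT0.le)
  refine ⟨T + δ, by linarith, X, ⟨?_, hXc.continuousOn, ?_, ?_, ?_⟩, ?_⟩
  · exact_mod_cast (show (0 : ℝ) < T + δ by linarith)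
  · intro τ
    rw [hXx _ ⟨τ.2.1, τ.2.2.trans_lt hT0⟩, hx.init]
  · exact fun t ht _ => hInt 0 t le_rfl ht
  · intro t ht htT
    rcases lt_or_ge t T with h | h
    · exact hbefore t ⟨ht, h⟩
    · rw [hX t ⟨h, (EReal.coe_lt_coe_iff.1 htT).le⟩, ← hXψ T le_rfl, hatT, add_assoc,
        intervalIntegral.integral_add_adjacent_intervals (hInt 0 T le_rfl hT0.le)
          (hInt T t hT0.le ht)]
  · exact fun t ht htT => hXx t ⟨ht, EReal.coe_lt_coe_iff.1 htT⟩

theorem ClassK.nonneg {κ : ℝ → ℝ} (hκ : ClassK κ) {s : ℝ} (hs : 0 ≤ s) : 0 ≤ κ s :=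
  hκ.2.2 ▸ hκ.2.1.monotoneOn self_mem_Ici hs hs

theorem ClassN.nonneg {κ : ℝ → ℝ} (hκ : ClassN κ) {s : ℝ} (hs : 0 ≤ s) : 0 ≤ κ s :=
  hκ.2.2 ▸ hκ.2.1 self_mem_Ici hs hs

theorem ClassK.comp {κ σ : ℝ → ℝ} (hκ : ClassK κ) (hσ : ClassK σ) :
    ClassK fun s => κ (σ s) :=
  ⟨hκ.1.comp hσ.1 fun _ hs => hσ.nonneg hs, hκ.2.1.comp hσ.2.1 fun _ hs => hσ.nonneg hs,
    by simp only [hσ.2.2, hκ.2.2]⟩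

theorem ClassK.comp_classN {κ σ : ℝ → ℝ} (hκ : ClassK κ) (hσ : ClassN σ) :
    ClassN fun s => κ (σ s) :=
  ⟨hκ.1.comp hσ.1 fun _ hs => hσ.nonneg hs,
    hκ.2.1.monotoneOn.comp hσ.2.1 fun _ hs => hσ.nonneg hs, by simp only [hσ.2.2, hκ.2.2]⟩

theorem ClassKL.comp_classK {β : ℝ → ℝ → ℝ} {κ σ : ℝ → ℝ} (hβ : ClassKL β) (hκ : ClassK κ)
    (hσ : ClassK σ) : ClassKL fun s t => κ (β (σ s) t) := by
  refine ⟨fun t ht => hκ.comp ((hβ.1 t ht).comp hσ), fun s hs => ?_⟩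
  obtain ⟨hc, ha, hlim⟩ := hβ.2 (σ s) (hσ.nonneg hs)
  have hnn : ∀ t ∈ Ici (0 : ℝ), 0 ≤ β (σ s) t := fun t ht => (hβ.1 t ht).nonneg (hσ.nonneg hs)
  refine ⟨hκ.1.comp hc hnn, hκ.2.1.monotoneOn.comp_AntitoneOn ha hnn, ?_⟩
  have h0 := hκ.1 0 self_mem_Ici
  rw [ContinuousWithinAt, hκ.2.2] at h0
  exact h0.comp (tendsto_nhdsWithin_iff.2 ⟨hlim, (eventually_ge_atTop 0).mono hnn⟩)

/-- The solution at time `t` of `d/dt Θ(log y) = -1`, `y(0) = M`, extended by zero to `M ≤ 0`. -/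
noncomputable def scaledDecay (Θ : ℝ ≃o ℝ) (M t : ℝ) : ℝ :=
  if M ≤ 0 then 0 else Real.exp (Θ.symm (Θ (Real.log M) - t))

theorem scaledDecay_of_nonpos (Θ : ℝ ≃o ℝ) {M : ℝ} (hM : M ≤ 0) (t : ℝ) :
    scaledDecay Θ M t = 0 := if_pos hM

theorem scaledDecay_of_pos (Θ : ℝ ≃o ℝ) {M : ℝ} (hM : 0 < M) (t : ℝ) :
    scaledDecay Θ M t = Real.exp (Θ.symm (Θ (Real.log M) - t)) := if_neg hM.not_ge

theorem scaledDecay_nonneg (Θ : ℝ ≃o ℝ) (M t : ℝ) : 0 ≤ scaledDecay Θ M t := by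
  unfold scaledDecay
  split_ifs <;> positivity

theorem scaledDecay_le_self (Θ : ℝ ≃o ℝ) {M t : ℝ} (hM : 0 ≤ M) (ht : 0 ≤ t) :
    scaledDecay Θ M t ≤ M := by
  rcases hM.eq_or_lt with rfl | hM
  · exact (scaledDecay_of_nonpos Θ le_rfl t).le
  · rw [scaledDecay_of_pos Θ hM, ← Real.le_log_iff_exp_le hM, Θ.symm_apply_le]
    linarith

theorem classKL_scaledDecay (Θ : ℝ ≃o ℝ) : ClassKL (scaledDecay Θ) := by
  refine ⟨fun t ht => ⟨fun M hM => ?_, fun M hM M' hM' hlt => ?_,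
    scaledDecay_of_nonpos Θ le_rfl t⟩, fun M hM => ?_⟩
  · rcases (mem_Ici.1 hM).eq_or_lt with rfl | hM
    · rw [ContinuousWithinAt, scaledDecay_of_nonpos Θ le_rfl]
      refine squeeze_zero' (Eventually.of_forall fun M => scaledDecay_nonneg Θ M t) ?_
        (tendsto_nhdsWithin_of_tendsto_nhds tendsto_id)
      filter_upwards [self_mem_nhdsWithin] with M hM using scaledDecay_le_self Θ hM ht
    · have h1 : ContinuousAt (fun M => Real.exp (Θ.symm (Θ (Real.log M) - t))) M :=
        Real.continuous_exp.continuousAt.comp (Θ.symm.continuous.continuousAt.comp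
          ((Θ.continuous.continuousAt.comp (Real.continuousAt_log hM.ne')).sub
            continuousAt_const))
      refine (h1.congr ?_).continuousWithinAt
      filter_upwards [lt_mem_nhds hM] with N hN using (scaledDecay_of_pos Θ hN t).symm
  · have hM'0 : 0 < M' := (mem_Ici.1 hM).trans_lt hlt
    simp only
    rw [scaledDecay_of_pos Θ hM'0]
    rcases (mem_Ici.1 hM).eq_or_lt with rfl | hM
    · rw [scaledDecay_of_nonpos Θ le_rfl]
      positivity
    · rw [scaledDecay_of_pos Θ hM]
      exact Real.exp_lt_exp.2 (Θ.symm.strictMono (sub_lt_sub_right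
        (Θ.strictMono (Real.log_lt_log hM hlt)) t))
  · rcases hM.eq_or_lt with rfl | hM
    · have h0 : scaledDecay Θ 0 = fun _ => 0 := funext (scaledDecay_of_nonpos Θ le_rfl)
      rw [h0]
      exact ⟨continuousOn_const, antitoneOn_const, tendsto_const_nhds⟩
    · have h0 : scaledDecay Θ M = fun t => Real.exp (Θ.symm (Θ (Real.log M) - t)) :=
        funext (scaledDecay_of_pos Θ hM)
      rw [h0]
      refine ⟨(Real.continuous_exp.comp (Θ.symm.continuous.comp
        (continuous_const.sub continuous_id))).continuousOn, fun a _ b _ hab => ?_, ?_⟩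
      · exact Real.exp_le_exp.2 (Θ.symm.monotone (sub_le_sub_left hab _))
      · exact Real.tendsto_exp_atBot.comp (Θ.symm.tendsto_atBot.comp
          (tendsto_atBot_add_const_left _ _ tendsto_neg_atTop_atBot))

theorem IsInput.essBnd_mono {m : ℕ} {u : ℝ → Vec m} (hu : IsInput u) {s t : ℝ} (hst : s ≤ t) :
    essBnd u (Icc 0 s) ≤ essBnd u (Icc 0 t) := by
  obtain ⟨h0, h⟩ := hu.ae_norm_le_essBnd t
  refine csInf_le ⟨0, fun C hC => hC.1⟩ ⟨h0, ?_⟩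
  filter_upwards [h] with r hr hrs using hr ⟨hrs.1, hrs.2.trans hst⟩

/-- Decay estimate along a solution, with the rate given by the time scale `Θ`. -/
theorem IsSolution.le_scaledDecay {Δ : ℝ≥0} {n m : ℕ} {f : Hist Δ n → Vec m → Vec n}
    (hf : LipOnBounded f) (hf0 : f 0 0 = 0) {ρ α γ : ℝ → ℝ} (hρK : ClassKinf ρ) (hγ : ClassN γ)
    {V : Vec n → ℝ} (hV : ContDiff ℝ 1 V) (hVnonneg : ∀ z, 0 ≤ V z)
    (hRaz : ∀ (φ : Hist Δ n) (v : Vec m),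
      max (ρ (⨆ τ : Icc (-(Δ : ℝ)) (0 : ℝ), V (φ τ))) (γ ‖v‖) ≤ V (ev0 φ) →
        fderiv ℝ V (ev0 φ) (f φ v) ≤ -α ‖ev0 φ‖)
    (hρ : ∀ s : ℝ, 0 < s → ρ s < s) {ℓ : ℝ → ℝ} (hℓ : Continuous ℓ) (hℓ1 : ∀ z, 1 ≤ ℓ z)
    (hℓα : ∀ x, 0 < V x → V x ≤ ℓ (Real.log (V x)) * α ‖x‖) {Θ : ℝ ≃o ℝ}
    (hΘ : ∀ z, HasDerivAt Θ (ℓ z) z)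
    (hΘρ : ∀ s, 0 < s → (Δ : ℝ) + 1 ≤ Θ (Real.log s) - Θ (Real.log (ρ s)))
    {u : ℝ → Vec m} (hu : IsInput u) {x₀ : Hist Δ n} {tmax : EReal} {x : ℝ → Vec n}
    (hx : IsSolution Δ f u x₀ tmax x) {M : ℝ} (hM : 0 ≤ M) (hx₀ : ∀ τ, V (x₀ τ) ≤ M)
    {t : ℝ} (ht : 0 ≤ t) (htmax : (t : EReal) < tmax) :
    V (x t) ≤ max (scaledDecay Θ M t) (γ (essBnd u (Icc 0 t))) := by
  obtain ⟨hU, hub⟩ := hu.ae_norm_le_essBnd t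
  have hxc : ContinuousOn x (Icc (-(Δ : ℝ)) t) :=
    hx.cont.mono fun s hs => ⟨hs.1, IsSolution.coe_lt_of_le htmax hs.2⟩
  have : Nonempty (Icc (-(Δ : ℝ)) (0 : ℝ)) := ⟨⟨0, zero_mem_IccD Δ⟩⟩
  have key : ∀ N, 0 < N → M ≤ N →
      V (x t) ≤ max (Real.exp (Θ.symm (Θ (Real.log N) - t))) (γ (essBnd u (Icc 0 t))) := by
    intro N hN hMN
    refine razumikhin_comparison (v := fun s => V (x s)) Θ Δ.coe_nonneg hρK hρ hΘρ hN
      (hV.continuous.comp_continuousOn hxc) (fun s hs => ?_) ?_ t ⟨ht, le_rfl⟩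
    · rw [hx.init ⟨s, hs⟩]
      exact (hx₀ _).trans hMN
    · intro a b B ha hab hbt hB hlow
      refine hx.time_scale_decay hf hf0 hu hV hℓ hΘ ha hab (IsSolution.coe_lt_of_le htmax hbt)
        (fun s hs => (hlow s hs).2.2) ?_
      filter_upwards [hub] with s hs hsab
      obtain ⟨h1, h2, h3⟩ := hlow s hsab
      have hsc : ContinuousOn x (Icc (s - (Δ : ℝ)) s) := hxc.mono
        (Icc_subset_Icc (by linarith [hsab.1]) (hsab.2.trans hbt))
      have hev : ev0 (seg Δ x s) = x s := by
        rw [ev0, seg_apply hsc]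
        simp
      have hsup : ⨆ τ : Icc (-(Δ : ℝ)) (0 : ℝ), V (seg Δ x s τ) ≤ B := by
        refine ciSup_le fun τ => ?_
        rw [seg_apply hsc]
        exact hB _ ⟨by linarith [τ.2.1, hsab.1], by linarith [τ.2.2, hsab.2]⟩
      have hsup0 : 0 ≤ ⨆ τ : Icc (-(Δ : ℝ)) (0 : ℝ), V (seg Δ x s τ) :=
        Real.iSup_nonneg fun τ => hVnonneg _
      have hfd := hRaz (seg Δ x s) (u s) (by
        rw [hev]
        refine max_le ((hρK.1.2.1.monotoneOn hsup0 (hsup0.trans hsup) hsup).trans h2) ?_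
        exact (hγ.2.1 (norm_nonneg _) hU
          (hs ⟨ha.trans hsab.1, hsab.2.trans hbt⟩)).trans h1)
      rw [hev] at hfd
      have h4 := mul_le_mul_of_nonneg_left hfd (zero_le_one.trans (hℓ1 (Real.log (V (x s)))))
      linarith [hℓα (x s) h3]
  rcases hM.eq_or_lt with rfl | hM
  · rw [scaledDecay_of_nonpos Θ le_rfl]
    refine le_of_forall_pos_le_add fun ε hε => (key ε hε hε.le).trans ?_
    rw [← scaledDecay_of_pos Θ hε]
    have h1 := scaledDecay_le_self Θ hε.le ht
    have h2 := le_max_left 0 (γ (essBnd u (Icc 0 t)))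
    have h3 := le_max_right 0 (γ (essBnd u (Icc 0 t)))
    exact max_le (by linarith) (by linarith)
  · rw [scaledDecay_of_pos Θ hM]
    exact key M hM le_rfl

theorem IsMaxSolution.eq_top {Δ : ℝ≥0} {n m : ℕ} {f : Hist Δ n → Vec m → Vec n}
    (hf : LipOnBounded f) (hf0 : f 0 0 = 0) {u : ℝ → Vec m} (hu : IsInput u) {x₀ : Hist Δ n}
    {tmax : EReal} {x : ℝ → Vec n} (hx : IsMaxSolution Δ f u x₀ tmax x)
    (hbdd : ∀ T : ℝ, ∃ C, ∀ t : ℝ, 0 ≤ t → t < T → (t : EReal) < tmax → ‖x t‖ ≤ C) :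
    tmax = ⊤ := by
  by_contra htop
  obtain ⟨hsol, hmax⟩ := hx
  lift tmax to ℝ using ⟨htop, (EReal.bot_lt_zero.trans hsol.tmax_pos).ne'⟩ with T
  obtain ⟨C, hC⟩ := hbdd T
  obtain ⟨T', hT', x', hx', hxx'⟩ := hsol.exists_extension hf hf0 hu (C := max ‖x₀‖ C) (by
    intro t ht
    rcases lt_or_ge t 0 with h | h
    · rw [hsol.init ⟨t, ht.1, h.le⟩]
      exact (x₀.norm_coe_le_norm _).trans (le_max_left _ _)
    · exact (hC t h ht.2 (EReal.coe_lt_coe_iff.2 ht.2)).trans (le_max_right _ _))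
  exact hT'.not_ge (EReal.coe_le_coe_iff.1 (hmax T' x' hx' hxx'))

/-- ISS through the Razumikhin approach. -/
theorem iss_razumikhin
    (Δ : ℝ≥0) (n m : ℕ) (f : Hist Δ n → Vec m → Vec n)
    (hf : LipOnBounded f) (hf0 : f 0 0 = 0)
    (ρ : ℝ → ℝ) (hρK : ClassKinf ρ) (α : ℝ → ℝ) (hα : ClassP α)
    (γ : ℝ → ℝ) (hγ : ClassN γ)
    (V : Vec n → ℝ) (hV : ContDiff ℝ 1 V) (hVnonneg : ∀ z : Vec n, 0 ≤ V z)
    (hV0 : V 0 = 0) (hVpos : ∀ z : Vec n, z ≠ 0 → 0 < V z)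
    (hVrad : ∀ M : ℝ, ∃ R : ℝ, ∀ z : Vec n, R ≤ ‖z‖ → M ≤ V z)
    (hRaz : ∀ (φ : Hist Δ n) (v : Vec m),
      max (ρ (⨆ τ : Icc (-(Δ : ℝ)) (0 : ℝ), V (φ τ))) (γ ‖v‖) ≤ V (ev0 φ) →
        fderiv ℝ V (ev0 φ) (f φ v) ≤ -α ‖ev0 φ‖)
    (hρ : ∀ s : ℝ, 0 < s → ρ s < s) :
    ISS Δ f := by
  obtain ⟨σ, lam, hσ, hlam, hσV, hlamV⟩ :=
    exists_classK_comparison hV.continuous hV0 hVnonneg hVpos hVrad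
  have hΔ : (0 : ℝ) ≤ Δ + 1 := by positivity
  obtain ⟨ℓ, hℓ, hℓ1, hℓα, hℓρ⟩ := exists_continuous_rate hV.continuous hV0 hVrad hρK hρ hα hΔ
  obtain ⟨Θ, hΘ, hΘℓ⟩ := exists_time_scale hℓ hℓ1
  have hΘρ : ∀ s, 0 < s → (Δ : ℝ) + 1 ≤ Θ (Real.log s) - Θ (Real.log (ρ s)) := by
    intro s hs
    have hρs : 0 < ρ s := hρK.1.2.2 ▸ hρK.1.2.1 self_mem_Ici hs.le hs
    exact hΘℓ _ _ _ (Real.log_le_log hρs (hρ s hs).le) fun z hz => hℓρ s z hs hz.1 hz.2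
  refine ⟨fun s t => lam (scaledDecay Θ (σ s) t), fun s => lam (γ s),
    (classKL_scaledDecay Θ).comp_classK hlam hσ, hlam.comp_classN hγ, ?_⟩
  intro x₀ u tmax x hu hx
  have hσ0 : 0 ≤ σ ‖x₀‖ := hσ.nonneg (norm_nonneg _)
  have hx₀ : ∀ τ, V (x₀ τ) ≤ σ ‖x₀‖ := fun τ =>
    (hσV _).trans (hσ.2.1.monotoneOn (norm_nonneg _) (norm_nonneg _) (x₀.norm_coe_le_norm τ))
  have key : ∀ t : ℝ, 0 ≤ t → (t : EReal) < tmax →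
      V (x t) ≤ max (scaledDecay Θ (σ ‖x₀‖) t) (γ (essBnd u (Icc 0 t))) := fun t ht htmax =>
    hx.1.le_scaledDecay hf hf0 hρK hγ hV hVnonneg hRaz hρ hℓ hℓ1 hℓα hΘ hΘρ hu hσ0 hx₀ ht htmax
  have hgain : ∀ t, 0 ≤ essBnd u (Icc 0 t) := fun t => (hu.ae_norm_le_essBnd t).1
  have htop : tmax = ⊤ := by
    refine hx.eq_top hf hf0 hu fun T => ⟨lam (max (σ ‖x₀‖) (γ (essBnd u (Icc 0 T)))),
      fun t ht htT htmax => (hlamV _).trans (hlam.2.1.monotoneOn (hVnonneg _)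
        (hσ0.trans (le_max_left _ _)) ((key t ht htmax).trans ?_))⟩
    exact max_le_max (scaledDecay_le_self Θ hσ0 ht)
      (hγ.2.1 (hgain t) (hgain T) (hu.essBnd_mono htT.le))
  refine ⟨htop, fun t ht => ?_⟩
  have h1 := key t ht (htop ▸ EReal.coe_lt_top t)
  have h2 := scaledDecay_nonneg Θ (σ ‖x₀‖) t
  have h3 := hγ.nonneg (hgain t)
  refine (hlamV _).trans ((hlam.2.1.monotoneOn (hVnonneg _) (h2.trans (le_max_left _ _)) h1).trans
    ?_)
  rw [hlam.2.1.monotoneOn.map_max h2 h3]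
  exact max_le_add_of_nonneg (hlam.nonneg h2) (hlam.nonneg h3)
end

section
/- Fix Δ ≥ 0, matrices A, A_{ij} ∈ ℝⁿˣⁿ (i = 1,…,m, j = 1,…,p), B ∈ ℝⁿˣᵐ, and delays Δⱼ ∈ [0,Δ]. Consider the bilinear time-delay system ẋ(t) = Ax(t) + Σ_{i=1}^m Σ_{j=1}^p uᵢ(t) A_{ij} x(t−Δⱼ) + Bu(t), i.e., ẋ(t) = f(x_t, u(t)) with f(φ,v) := Aφ(0) + Σ_{i=1}^m Σ_{j=1}^p vᵢ A_{ij} φ(−Δⱼ) + Bv. Then this system is iISS if and only if A is Hurwitz, i.e., every eigenvalue of A has strictly negative real part. -/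
open Set Filter MeasureTheory Topology
open scoped NNReal

/-! ### Absolutely continuous functions -/

theorem AbsolutelyContinuousOnInterval.of_dist_le {X Y Z : Type*} [PseudoMetricSpace X]
    [PseudoMetricSpace Y] [PseudoMetricSpace Z] {f : ℝ → X} {g : ℝ → Y} {h : ℝ → Z} {a b : ℝ}
    (C D : ℝ) (hg : AbsolutelyContinuousOnInterval g a b)
    (hh : AbsolutelyContinuousOnInterval h a b)
    (hf : ∀ x ∈ uIcc a b, ∀ y ∈ uIcc a b,
      dist (f x) (f y) ≤ C * dist (g x) (g y) + D * dist (h x) (h y)) :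
    AbsolutelyContinuousOnInterval f a b := by
  unfold AbsolutelyContinuousOnInterval at hg hh ⊢
  refine squeeze_zero' ?_ ?_ (by simpa using (hg.const_mul C).add (hh.const_mul D))
  · exact Eventually.of_forall fun _ => Finset.sum_nonneg fun _ _ => dist_nonneg
  rw [eventually_inf_principal]
  filter_upwards with I hI
  rw [Finset.mul_sum, Finset.mul_sum, ← Finset.sum_add_distrib]
  exact Finset.sum_le_sum fun i hi => hf _ (hI.1 i hi).1 _ (hI.1 i hi).2

theorem IntervalIntegrable.absolutelyContinuousOnInterval_integral {E : Type*}
    [NormedAddCommGroup E] [NormedSpace ℝ E] {f : ℝ → E} {a b : ℝ}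
    (h : IntervalIntegrable f volume a b) :
    AbsolutelyContinuousOnInterval (fun x => ∫ v in a..x, f v) a b := by
  have hn := h.norm.absolutelyContinuousOnInterval_intervalIntegral (c := a) left_mem_uIcc
  refine .of_dist_le 1 0 hn hn fun x hx y hy => ?_
  rw [dist_eq_norm, dist_eq_norm, intervalIntegral.integral_interval_sub_left
      (h.mono_set (uIcc_subset_uIcc left_mem_uIcc hx))
      (h.mono_set (uIcc_subset_uIcc left_mem_uIcc hy)),
    intervalIntegral.integral_interval_sub_left
      (h.norm.mono_set (uIcc_subset_uIcc left_mem_uIcc hx))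
      (h.norm.mono_set (uIcc_subset_uIcc left_mem_uIcc hy)), Real.norm_eq_abs]
  simpa using intervalIntegral.norm_integral_le_abs_integral_norm (f := f) (a := y) (b := x)

/-- Variation of constants: `P` is a propagator of `ẋ = 𝒜 x`, read backwards in time. -/
theorem variation_of_constants {E : Type*} [NormedAddCommGroup E] [NormedSpace ℝ E]
    [CompleteSpace E] {T : ℝ} (hT : 0 ≤ T) {𝒜 : E →L[ℝ] E} {P : ℝ → E →L[ℝ] E}
    (hP : ∀ s, HasDerivAt P (-(P s ∘L 𝒜)) s) {X g : ℝ → E} (hXc : ContinuousOn X (Icc 0 T))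
    (hg : IntervalIntegrable g volume 0 T)
    (hX : ∀ t ∈ Icc 0 T, X t = X 0 + ∫ s in (0 : ℝ)..t, (𝒜 (X s) + g s)) :
    P T (X T) = P 0 (X 0) + ∫ s in (0 : ℝ)..T, P s (g s) := by
  have hPc : Continuous P := continuous_iff_continuousAt.2 fun s => (hP s).continuousAt
  have hPac : AbsolutelyContinuousOnInterval P 0 T := by
    refine ContDiffOn.absolutelyContinuousOnInterval (ContDiff.contDiffOn ?_)
    rw [contDiff_one_iff_deriv]
    refine ⟨fun s => (hP s).differentiableAt, ?_⟩
    rw [show deriv P = fun s => -(P s ∘L 𝒜) from funext fun s => (hP s).deriv]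
    exact (hPc.clm_comp continuous_const).neg
  have hI : uIcc 0 T = Icc 0 T := uIcc_of_le hT
  have hAX : IntervalIntegrable (fun s => 𝒜 (X s) + g s) volume 0 T := by
    refine IntervalIntegrable.add (ContinuousOn.intervalIntegrable ?_) hg
    rw [hI]
    exact 𝒜.continuous.comp_continuousOn hXc
  have hPg : IntervalIntegrable (fun s => P s (g s)) volume 0 T := by
    obtain ⟨C, hC⟩ := isCompact_Icc.exists_bound_of_continuousOn (hPc.continuousOn (s := Icc 0 T))
    refine (hg.norm.const_mul C).mono_fun ?_ ?_
    · have : Continuous fun q : (E →L[ℝ] E) × E => q.1 q.2 := by fun_prop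
      exact this.comp_aestronglyMeasurable
        (hPc.aestronglyMeasurable.prodMk hg.aestronglyMeasurable_restrict_uIoc)
    · refine (ae_restrict_iff' measurableSet_uIoc).2 (Eventually.of_forall fun s hs => ?_)
      have hs' : s ∈ Icc 0 T := hI ▸ uIoc_subset_uIcc hs
      calc ‖P s (g s)‖ ≤ ‖P s‖ * ‖g s‖ := (P s).le_opNorm _
        _ ≤ C * ‖g s‖ := by gcongr; exact hC s hs'
        _ ≤ ‖C * ‖g s‖‖ := le_abs_self _
  set Y : ℝ → E := fun t => X 0 + ∫ s in (0 : ℝ)..t, (𝒜 (X s) + g s) with hY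
  have hYX : ∀ t ∈ Icc 0 T, Y t = X t := fun t ht => (hX t ht).symm
  have hYac : AbsolutelyContinuousOnInterval Y 0 T := by
    have := hAX.absolutelyContinuousOnInterval_integral
    exact .of_dist_le 1 0 this this fun x _ y _ => by simp [hY]
  have hPYac : AbsolutelyContinuousOnInterval (fun s => P s (Y s)) 0 T := by
    obtain ⟨C, hC⟩ := hPac.exists_bound
    obtain ⟨D, hD⟩ := hYac.exists_bound
    refine .of_dist_le C D hYac hPac fun x hx y hy => ?_
    have : P x (Y x) - P y (Y y) = P x (Y x - Y y) + (P x - P y) (Y y) := by simp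
    rw [dist_eq_norm, dist_eq_norm, dist_eq_norm, this]
    calc _ ≤ ‖P x‖ * ‖Y x - Y y‖ + ‖P x - P y‖ * ‖Y y‖ :=
          (norm_add_le _ _).trans (add_le_add ((P x).le_opNorm _) ((P x - P y).le_opNorm _))
      _ ≤ C * ‖Y x - Y y‖ + ‖P x - P y‖ * D := by
          gcongr
          · exact hC x hx
          · exact hD y hy
      _ = _ := by ring
  obtain ⟨c, hc⟩ := (hPYac.fun_sub
    hPg.absolutelyContinuousOnInterval_integral).const_of_ae_hasDerivAt_zero (by
      filter_upwards [hAX.ae_hasDerivAt_integral, hPg.ae_hasDerivAt_integral] with s h1 h2 hs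
      have hYd : HasDerivAt Y (𝒜 (X s) + g s) s := (h1 hs 0 left_mem_uIcc).const_add _
      have := ((hP s).clm_apply hYd).sub (h2 hs 0 left_mem_uIcc)
      convert! this using 1
      simp [hYX s (hI ▸ hs)])
  have h0 := hc 0 left_mem_uIcc
  have h1 := hc T right_mem_uIcc
  simp only [intervalIntegral.integral_same, sub_zero] at h0
  rw [hYX 0 (left_mem_Icc.2 hT)] at h0
  rw [hYX T (right_mem_Icc.2 hT), ← h0, sub_eq_iff_eq_add] at h1
  exact h1

/-! ### Grönwall's inequality with an integrable kernel -/

theorem integral_mul_exp_integral {k : ℝ → ℝ} {T : ℝ} (hk : IntervalIntegrable k volume 0 T)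
    (ρ : ℝ) {t : ℝ} (ht : t ∈ uIcc 0 T) :
    ∫ s in (0 : ℝ)..t, ρ * k s * Real.exp (ρ * ∫ v in (0 : ℝ)..s, k v)
      = Real.exp (ρ * ∫ v in (0 : ℝ)..t, k v) - 1 := by
  replace hk : IntervalIntegrable k volume 0 t :=
    hk.mono_set (uIcc_subset_uIcc left_mem_uIcc ht)
  set U : ℝ → ℝ := fun s => ρ * ∫ v in (0 : ℝ)..s, k v with hU
  have hUac : AbsolutelyContinuousOnInterval U 0 t :=
    hk.absolutelyContinuousOnInterval_integral.const_mul ρ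
  have hint : IntervalIntegrable (fun s => ρ * k s * Real.exp (U s)) volume 0 t :=
    (hk.const_mul ρ).mul_continuousOn (Real.continuous_exp.comp_continuousOn hUac.continuousOn)
  have heac : AbsolutelyContinuousOnInterval (fun s => Real.exp (U s)) 0 t := by
    obtain ⟨M, hM⟩ := hUac.exists_bound
    refine .of_dist_le (Real.exp M) 0 hUac hUac fun x hx y hy => ?_
    have := Convex.norm_image_sub_le_of_norm_hasDerivWithin_le (f := Real.exp) (f' := Real.exp)
      (s := Iic M) (C := Real.exp M) (x := U y) (y := U x)
      (fun z _ => (Real.hasDerivAt_exp z).hasDerivWithinAt)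
      (fun z hz => by rw [Real.norm_eq_abs, Real.abs_exp]; exact Real.exp_le_exp.2 hz)
      (convex_Iic M) ((le_abs_self _).trans (hM y hy)) ((le_abs_self _).trans (hM x hx))
    simpa [dist_eq_norm] using this
  obtain ⟨c, hc⟩ := (heac.fun_sub
    hint.absolutelyContinuousOnInterval_integral).const_of_ae_hasDerivAt_zero (by
      filter_upwards [hk.ae_hasDerivAt_integral, hint.ae_hasDerivAt_integral] with s h1 h2 hs
      have hUd : HasDerivAt U (ρ * k s) s := (h1 hs 0 left_mem_uIcc).const_mul ρ
      convert! hUd.exp.sub (h2 hs 0 left_mem_uIcc) using 1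
      ring)
  have h0 := hc 0 left_mem_uIcc
  have h1 := hc t right_mem_uIcc
  simp only [hU, intervalIntegral.integral_same, sub_zero, mul_zero, Real.exp_zero] at h0 h1
  linarith

/-- A Grönwall inequality whose hypothesis only involves the running bound of `m`, so that it
applies to functional differential inequalities. -/
theorem gronwall_of_running_bound {k m : ℝ → ℝ} {N T : ℝ}
    (hk : IntervalIntegrable k volume 0 T) (hm : ContinuousOn m (Icc 0 T))
    (h : ∀ t ∈ Icc 0 T, ∀ M, N ≤ M →
      (∀ s ∈ Icc 0 t, m s ≤ M * Real.exp (∫ v in (0 : ℝ)..s, k v)) →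
      m t ≤ N + ∫ s in (0 : ℝ)..t, k s * (M * Real.exp (∫ v in (0 : ℝ)..s, k v)))
    {t : ℝ} (ht : t ∈ Icc 0 T) :
    m t ≤ N * Real.exp (∫ v in (0 : ℝ)..t, k v) := by
  have hT : 0 ≤ T := ht.1.trans ht.2
  set U : ℝ → ℝ := fun s => ∫ v in (0 : ℝ)..s, k v with hU
  have hUc : ContinuousOn U (Icc 0 T) := by
    have := hk.absolutelyContinuousOnInterval_integral.continuousOn
    rwa [uIcc_of_le hT] at this
  obtain ⟨t₀, ht₀, hmax⟩ := isCompact_Icc.exists_isMaxOn (nonempty_Icc.2 hT)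
    (hm.mul (Real.continuous_exp.comp_continuousOn hUc.neg))
  set M₀ := m t₀ * Real.exp (-U t₀) with hM₀
  have hle : ∀ s ∈ Icc 0 T, m s ≤ M₀ * Real.exp (U s) := fun s hs => by
    have h1 : m s * Real.exp (-U s) ≤ M₀ := hmax hs
    rwa [Real.exp_neg, ← div_eq_mul_inv, div_le_iff₀ (Real.exp_pos _)] at h1
  suffices M₀ ≤ N from (hle t ht).trans (by gcongr)
  by_contra! hlt
  have h1 := h t₀ ht₀ M₀ hlt.le fun s hs => hle s ⟨hs.1, hs.2.trans ht₀.2⟩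
  have h2 := integral_mul_exp_integral hk 1 (t := t₀) (by rwa [uIcc_of_le hT])
  simp only [one_mul] at h2
  have h3 : ∫ s in (0 : ℝ)..t₀, k s * (M₀ * Real.exp (U s)) = M₀ * (Real.exp (U t₀) - 1) := by
    rw [← h2, ← intervalIntegral.integral_const_mul]
    exact intervalIntegral.integral_congr fun s _ => by simp only [hU]; ring
  have h4 : m t₀ = M₀ * Real.exp (U t₀) := by
    rw [hM₀, mul_assoc, ← Real.exp_add]; simp
  rw [h3, h4] at h1
  linarith

/-! ### Existence for functional equations with an integrable Lipschitz kernel -/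

/-- A causal functional equation with an integrable Lipschitz kernel `k` is solvable on `[0, T]`
from every continuous past `x₀`. -/
theorem exists_causal_integral_eq {E : Type*} [NormedAddCommGroup E] [NormedSpace ℝ E]
    [CompleteSpace E] {T : ℝ} (hT : 0 ≤ T) {F : ℝ → (ℝ → E) → E} {k : ℝ → ℝ}
    (hk : IntervalIntegrable k volume 0 T) (hk0 : ∀ s, 0 ≤ k s)
    (hFint : ∀ x : ℝ → E, Continuous x → IntervalIntegrable (fun s => F s x) volume 0 T)
    (hF : ∀ s ∈ Icc 0 T, ∀ (x y : ℝ → E) (R : ℝ), (∀ τ ≤ s, ‖x τ - y τ‖ ≤ R) →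
      ‖F s x - F s y‖ ≤ k s * R)
    {x₀ : ℝ → E} (hx₀ : Continuous x₀) :
    ∃ x : ℝ → E, Continuous x ∧ (∀ τ ≤ 0, x τ = x₀ τ) ∧
      ∀ t ∈ Icc 0 T, x t = x 0 + ∫ s in (0 : ℝ)..t, F s x := by
  have hI : uIcc 0 T = Icc 0 T := uIcc_of_le hT
  set U : ℝ → ℝ := fun s => ∫ v in (0 : ℝ)..s, k v with hU
  have hUc : ContinuousOn U (Icc 0 T) := hI ▸
    hk.absolutelyContinuousOnInterval_integral.continuousOn
  have hU0 : U 0 = 0 := intervalIntegral.integral_same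
  have hUmono : ∀ s ∈ Icc 0 T, ∀ t ∈ Icc 0 T, s ≤ t → U s ≤ U t := fun s hs t ht hst =>
    intervalIntegral.integral_mono_interval le_rfl hs.1 hst (Eventually.of_forall hk0)
      (hk.mono_set (uIcc_subset_uIcc left_mem_uIcc (hI ▸ ht)))
  have hUpos : ∀ s ∈ Icc 0 T, 0 ≤ U s := fun s hs =>
    hU0 ▸ hUmono 0 (left_mem_Icc.2 hT) s hs hs.1
  let pr : ℝ → Icc (0 : ℝ) T := projIcc 0 T hT
  have hpr : Continuous pr := continuous_projIcc
  have hpr0 : ∀ τ ≤ 0, pr τ = pr 0 := fun τ hτ => by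
    simp only [pr]; rw [projIcc_of_le_left hT hτ, projIcc_of_le_left hT le_rfl]
  have hprI : ∀ t (ht : t ∈ Icc 0 T), pr t = ⟨t, ht⟩ := fun t ht => projIcc_of_mem hT ht
  have hprle : ∀ s ∈ Icc 0 T, ∀ τ ≤ s, (pr τ : ℝ) ≤ s := fun s hs τ hτ => by
    have := monotone_projIcc hT hτ
    calc (pr τ : ℝ) ≤ pr s := this
      _ = s := by rw [hprI s hs]
  let w : ℝ → ℝ := fun τ => Real.exp (4 * U (pr τ))
  have hw : Continuous w := by
    refine Real.continuous_exp.comp (continuous_const.mul ?_)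
    exact hUc.comp_continuous (continuous_subtype_val.comp hpr) fun τ => (pr τ).2
  have hw0 : w 0 = 1 := by
    simp only [w]; rw [hprI 0 (left_mem_Icc.2 hT)]; simp [hU0]
  let X : C(Icc (0 : ℝ) T, E) → ℝ → E := fun y τ =>
    x₀ (min τ 0) + (w τ • y (pr τ) - y (pr 0))
  have hXc : ∀ y, Continuous (X y) := fun y => by
    have h1 : Continuous fun τ : ℝ => x₀ (min τ 0) := hx₀.comp (continuous_id.min continuous_const)
    exact h1.add ((hw.smul (y.continuous.comp hpr)).sub continuous_const)
  have hXdiff : ∀ y z, ∀ s ∈ Icc 0 T, ∀ τ ≤ s,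
      ‖X y τ - X z τ‖ ≤ 2 * Real.exp (4 * U s) * ‖y - z‖ := fun y z s hs τ hτ => by
    have h1 : X y τ - X z τ = w τ • (y - z) (pr τ) - (y - z) (pr 0) := by
      simp only [X, ContinuousMap.sub_apply, smul_sub]; abel
    have h2 : w τ ≤ Real.exp (4 * U s) :=
      Real.exp_le_exp.2 (by linarith [hUmono _ (pr τ).2 s hs (hprle s hs τ hτ)])
    have h3 : 1 ≤ Real.exp (4 * U s) := Real.one_le_exp (by linarith [hUpos s hs])
    rw [h1]
    calc _ ≤ w τ * ‖y - z‖ + ‖y - z‖ := by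
          refine (norm_sub_le _ _).trans (add_le_add ?_ ((y - z).norm_coe_le_norm _))
          rw [norm_smul, Real.norm_eq_abs, abs_of_pos (Real.exp_pos _)]
          exact mul_le_mul_of_nonneg_left ((y - z).norm_coe_le_norm _) (Real.exp_pos _).le
      _ ≤ Real.exp (4 * U s) * ‖y - z‖ + Real.exp (4 * U s) * ‖y - z‖ := by
          gcongr
          exact le_mul_of_one_le_left (norm_nonneg _) h3
      _ = _ := by ring
  have hFX : ∀ y, ∀ t ∈ Icc 0 T, IntervalIntegrable (fun s => F s (X y)) volume 0 t :=
    fun y t ht => (hFint _ (hXc y)).mono_set (uIcc_subset_uIcc left_mem_uIcc (hI ▸ ht))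
  let Φ : C(Icc (0 : ℝ) T, E) → C(Icc (0 : ℝ) T, E) := fun y =>
    { toFun := fun t => Real.exp (-(4 * U t)) • ∫ s in (0 : ℝ)..t, F s (X y)
      continuous_toFun := by
        have h1 : ContinuousOn (fun t => Real.exp (-(4 * U t)) • ∫ s in (0 : ℝ)..t, F s (X y))
            (Icc 0 T) := by
          refine (Real.continuous_exp.comp_continuousOn (continuousOn_const.mul hUc).neg).smul ?_
          exact hI ▸
            (hFint _ (hXc y)).absolutelyContinuousOnInterval_integral.continuousOn
        exact h1.comp_continuous continuous_subtype_val fun t => t.2 }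
  have hΦ : ContractingWith (1 / 2) Φ := by
    refine ⟨by rw [← NNReal.coe_lt_coe]; norm_num, LipschitzWith.of_dist_le_mul fun y z => ?_⟩
    rw [dist_eq_norm, dist_eq_norm, ContinuousMap.norm_le _ (by positivity)]
    rintro ⟨t, ht⟩
    have h1 : (Φ y - Φ z) ⟨t, ht⟩
        = Real.exp (-(4 * U t)) • ∫ s in (0 : ℝ)..t, (F s (X y) - F s (X z)) := by
      rw [intervalIntegral.integral_sub (hFX y t ht) (hFX z t ht), smul_sub]; rfl
    have hkt : IntervalIntegrable k volume 0 t :=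
      hk.mono_set (uIcc_subset_uIcc left_mem_uIcc (hI ▸ ht))
    have h2 : ‖∫ s in (0 : ℝ)..t, (F s (X y) - F s (X z))‖
        ≤ ∫ s in (0 : ℝ)..t, (1 / 2 * ‖y - z‖) * (4 * k s * Real.exp (4 * U s)) := by
      refine intervalIntegral.norm_integral_le_of_norm_le ht.1
        (Eventually.of_forall fun s hs => ?_) ?_
      · have hs' : s ∈ Icc 0 T := ⟨hs.1.le, hs.2.trans ht.2⟩
        refine (hF s hs' _ _ _ (hXdiff y z s hs')).trans (le_of_eq ?_)
        ring
      · refine ((hkt.const_mul 4).mul_continuousOn ?_).const_mul _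
        rw [uIcc_of_le ht.1]
        exact Real.continuous_exp.comp_continuousOn
          (continuousOn_const.mul (hUc.mono (Icc_subset_Icc_right ht.2)))
    rw [intervalIntegral.integral_const_mul, integral_mul_exp_integral hk 4 (hI ▸ ht)] at h2
    rw [h1, norm_smul, Real.norm_eq_abs, abs_of_pos (Real.exp_pos _)]
    calc _ ≤ Real.exp (-(4 * U t)) * (1 / 2 * ‖y - z‖ * (Real.exp (4 * U t) - 1)) := by gcongr
      _ ≤ Real.exp (-(4 * U t)) * (1 / 2 * ‖y - z‖ * Real.exp (4 * U t)) := by gcongr; linarith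
      _ = (Real.exp (-(4 * U t)) * Real.exp (4 * U t)) * (1 / 2 * ‖y - z‖) := by ring
      _ = _ := by rw [← Real.exp_add]; simp
  obtain ⟨y, hy⟩ : ∃ y, Φ y = y := ⟨_, hΦ.fixedPoint_isFixedPt⟩
  have hyt : ∀ t (ht : t ∈ Icc 0 T),
      Real.exp (4 * U t) • y ⟨t, ht⟩ = ∫ s in (0 : ℝ)..t, F s (X y) := fun t ht => by
    conv_lhs => rw [← hy]
    change Real.exp (4 * U t) • (Real.exp (-(4 * U t)) • ∫ s in (0 : ℝ)..t, F s (X y)) = _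
    rw [smul_smul, ← Real.exp_add]
    simp
  refine ⟨X y, hXc y, fun τ hτ => ?_, fun t ht => ?_⟩
  · have : w τ = 1 := by rw [← hw0]; simp only [w]; rw [hpr0 τ hτ]
    simp only [X]
    rw [this, hpr0 τ hτ, min_eq_left hτ]
    simp
  · have h0 : y (pr 0) = 0 := by
      have := hyt 0 (left_mem_Icc.2 hT)
      rw [hprI 0 (left_mem_Icc.2 hT)]
      simpa [hU0] using this
    have hX0 : X y 0 = x₀ 0 := by simp [X, hw0]
    rw [hX0, ← hyt t ht]
    simp only [X, w]
    rw [h0, hprI t ht, min_eq_right ht.1, sub_zero]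

/-! ### Exponential decay of Hurwitz semigroups -/

theorem exp_apply_of_apply_eq_smul {E : Type*} [NormedAddCommGroup E] [NormedSpace ℂ E]
    [CompleteSpace E] {𝒜 : E →L[ℂ] E} {μ : ℂ} {v : E} (hv : 𝒜 v = μ • v) :
    NormedSpace.exp 𝒜 v = Complex.exp μ • v := by
  have hpow : ∀ k : ℕ, (𝒜 ^ k) v = μ ^ k • v := fun k => by
    induction k with
    | zero => simp
    | succ k ih =>
      rw [pow_succ, mul_apply_eq_comp, hv, map_smul, ih, smul_smul, pow_succ']
  have h1 := (NormedSpace.exp_series_hasSum_exp' (𝕂 := ℂ) 𝒜).mapL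
    (ContinuousLinearMap.apply ℂ E v)
  have h2 := (NormedSpace.exp_series_hasSum_exp' (𝕂 := ℂ) μ).smul_const v
  rw [← Complex.exp_eq_exp_ℂ] at h2
  refine h1.unique ?_
  convert h2 using 2 with k
  simp [hpow, smul_smul]

theorem norm_lt_one_of_mem_spectrum_exp {E : Type*} [NormedAddCommGroup E] [NormedSpace ℂ E]
    [FiniteDimensional ℂ E] {𝒜 : E →L[ℂ] E}
    (h : ∀ (μ : ℂ) (v : E), v ≠ 0 → 𝒜 v = μ • v → μ.re < 0)
    {z : ℂ} (hz : z ∈ spectrum ℂ (NormedSpace.exp 𝒜)) : ‖z‖ < 1 := by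
  have : CompleteSpace E := FiniteDimensional.complete ℂ E
  let e := Module.End.toContinuousLinearMap (𝕜 := ℂ) E
  have hz' : z ∈ spectrum ℂ (e.symm (NormedSpace.exp 𝒜)) := by
    rwa [AlgEquiv.spectrum_eq]
  rw [← Module.End.hasEigenvalue_iff_mem_spectrum] at hz'
  have hcomm : Commute (e.symm (NormedSpace.exp 𝒜)) (e.symm 𝒜) :=
    ((Commute.refl 𝒜).exp_right.symm).map e.symm
  set V := Module.End.eigenspace (e.symm (NormedSpace.exp 𝒜)) z with hV
  have hmaps : MapsTo (e.symm 𝒜) V V := Module.End.mapsTo_genEigenspace_of_comm hcomm z 1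
  have : Nontrivial V := Submodule.nontrivial_iff_ne_bot.2 hz'
  obtain ⟨μ, hμ⟩ := Module.End.exists_eigenvalue ((e.symm 𝒜).restrict hmaps)
  obtain ⟨w, hw⟩ := hμ.exists_hasEigenvector
  have hw1 : 𝒜 (w : E) = μ • (w : E) := congrArg Subtype.val hw.apply_eq_smul
  have hw0 : (w : E) ≠ 0 := fun h0 => hw.2 (Subtype.ext h0)
  have hw2 : NormedSpace.exp 𝒜 (w : E) = z • (w : E) := Module.End.mem_eigenspace_iff.1 w.2
  rw [exp_apply_of_apply_eq_smul hw1] at hw2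
  rw [← smul_left_injective ℂ hw0 hw2, Complex.norm_exp]
  exact Real.exp_lt_one_iff.2 (h μ w hw0 hw1)

theorem exists_norm_exp_smul_lt_one {E : Type*} [NormedAddCommGroup E] [NormedSpace ℂ E]
    [FiniteDimensional ℂ E] {𝒜 : E →L[ℂ] E}
    (h : ∀ (μ : ℂ) (v : E), v ≠ 0 → 𝒜 v = μ • v → μ.re < 0) :
    ∃ k : ℕ, 0 < k ∧ ‖NormedSpace.exp ((k : ℝ) • 𝒜)‖ < 1 := by
  have : CompleteSpace E := FiniteDimensional.complete ℂ E
  have hr : spectralRadius ℂ (NormedSpace.exp 𝒜) < 1 := by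
    rcases subsingleton_or_nontrivial E with hE | hE
    · rw [spectrum.SpectralRadius.of_subsingleton]; exact one_pos
    · exact_mod_cast spectrum.spectralRadius_lt_of_forall_lt_of_nonempty
        (spectrum.nonempty (NormedSpace.exp 𝒜)) (r := 1) fun z hz => by
          exact_mod_cast norm_lt_one_of_mem_spectrum_exp h hz
  have hG := spectrum.pow_nnnorm_pow_one_div_tendsto_nhds_spectralRadius (NormedSpace.exp 𝒜)
  obtain ⟨k, hk, hk0⟩ := ((hG.eventually (gt_mem_nhds hr)).and (eventually_gt_atTop 0)).exists
  refine ⟨k, hk0, ?_⟩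
  have hk1 : (‖NormedSpace.exp 𝒜 ^ k‖₊ : ENNReal) < 1 := by
    by_contra! hcon
    exact absurd hk (not_lt.2 (ENNReal.one_le_rpow hcon (by positivity)))
  have h2 : (k : ℝ) • 𝒜 = k • 𝒜 := Nat.cast_smul_eq_nsmul ℝ k 𝒜
  have : NormedAlgebra ℚ (E →L[ℂ] E) := NormedAlgebra.restrictScalars ℚ ℂ (E →L[ℂ] E)
  rw [h2, NormedSpace.exp_nsmul]
  exact_mod_cast hk1

theorem exists_norm_exp_smul_le {E : Type*} [NormedAddCommGroup E] [NormedSpace ℂ E]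
    [FiniteDimensional ℂ E] {𝒜 : E →L[ℂ] E}
    (h : ∀ (μ : ℂ) (v : E), v ≠ 0 → 𝒜 v = μ • v → μ.re < 0) :
    ∃ K lam : ℝ, 1 ≤ K ∧ 0 < lam ∧
      ∀ t : ℝ, 0 ≤ t → ‖NormedSpace.exp (t • 𝒜)‖ ≤ K * Real.exp (-lam * t) := by
  have : CompleteSpace E := FiniteDimensional.complete ℂ E
  have : NormedAlgebra ℚ (E →L[ℂ] E) := NormedAlgebra.restrictScalars ℚ ℂ (E →L[ℂ] E)
  obtain ⟨k, hk, hq⟩ := exists_norm_exp_smul_lt_one h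
  have hkR : (0 : ℝ) < k := by exact_mod_cast hk
  have hcont : Continuous fun t : ℝ => NormedSpace.exp (t • 𝒜) :=
    (NormedSpace.exp_continuous (𝔸 := E →L[ℂ] E)).comp (continuous_id.smul continuous_const)
  obtain ⟨C, hC⟩ := (isCompact_Icc (a := (0 : ℝ)) (b := k)).exists_bound_of_continuousOn
    hcont.continuousOn
  obtain ⟨q, hq1, hq2⟩ := exists_between (max_lt hq one_pos)
  have hq0 : 0 < q := (le_max_right _ _).trans_lt hq1
  have hqle : ‖NormedSpace.exp ((k : ℝ) • 𝒜)‖ ≤ q := (le_max_left _ _).trans hq1.le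
  have hlog : Real.log q < 0 := Real.log_neg hq0 hq2
  have hqexp : Real.exp (Real.log q) = q := Real.exp_log hq0
  refine ⟨max C 1 * q⁻¹, -Real.log q / k, ?_, div_pos (neg_pos.2 hlog) hkR, fun t ht => ?_⟩
  · exact one_le_mul_of_one_le_of_one_le (le_max_right _ _) ((one_le_inv₀ hq0).2 hq2.le)
  set j := ⌊t / k⌋₊ with hj
  have hj1 : j * (k : ℝ) ≤ t := (le_div_iff₀ hkR).1 (Nat.floor_le (by positivity))
  have hj2 : t < (j + 1) * k := (div_lt_iff₀ hkR).1 (Nat.lt_floor_add_one _)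
  have hsplit : t • 𝒜 = (t - j * k) • 𝒜 + j • ((k : ℝ) • 𝒜) := by
    rw [← Nat.cast_smul_eq_nsmul ℝ j, smul_smul, ← add_smul]; ring_nf
  have hcomm : Commute ((t - j * k) • 𝒜) (j • ((k : ℝ) • 𝒜)) :=
    ((((Commute.refl 𝒜).smul_right (k : ℝ)).smul_right j).smul_left _)
  rw [hsplit, NormedSpace.exp_add_of_commute hcomm, NormedSpace.exp_nsmul]
  have h1 : ‖NormedSpace.exp ((t - j * k) • 𝒜)‖ ≤ max C 1 :=
    (hC _ ⟨by linarith, by linarith⟩).trans (le_max_left _ _)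
  have h2 : ‖NormedSpace.exp ((k : ℝ) • 𝒜) ^ j‖ ≤ q⁻¹ * Real.exp (-(-Real.log q / k) * t) := by
    have h3 : ‖NormedSpace.exp ((k : ℝ) • 𝒜) ^ j‖ ≤ q ^ j := by
      rcases Nat.eq_zero_or_pos j with h0 | h0
      · rw [h0, pow_zero, pow_zero]
        exact ContinuousLinearMap.norm_id_le
      · exact (norm_pow_le' _ h0).trans (pow_le_pow_left₀ (norm_nonneg _) hqle _)
    refine h3.trans ?_
    nth_rewrite 1 [← hqexp]
    nth_rewrite 2 [← hqexp]
    rw [← Real.exp_nat_mul, ← Real.exp_neg, ← Real.exp_add, Real.exp_le_exp]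
    have h4 : t / k ≤ j + 1 := ((div_lt_iff₀ hkR).2 hj2).le
    have h5 : -(-Real.log q / k) * t = Real.log q * (t / k) := by ring
    rw [h5]
    nlinarith
  calc _ ≤ _ := norm_mul_le _ _
    _ ≤ max C 1 * (q⁻¹ * Real.exp (-(-Real.log q / k) * t)) := by gcongr
    _ = _ := by ring

/-! ### The bilinear vector field -/

theorem IsInput.intervalIntegrable {m : ℕ} {u : ℝ → Vec m} (hu : IsInput u) {T : ℝ}
    (hT : 0 ≤ T) : IntervalIntegrable u volume 0 T := by
  rcases hT.eq_or_lt with rfl | hT'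
  · exact IntervalIntegrable.refl
  obtain ⟨C, hC⟩ := hu.2 T hT'
  rw [intervalIntegrable_iff_integrableOn_Icc_of_le hT]
  exact Measure.integrableOn_of_bounded (M := C) (by simp) hu.1.aestronglyMeasurable
    ((ae_restrict_iff' measurableSet_Icc).2 hC)

/-- The coupling `∑ᵢ ∑ⱼ vᵢ Aᵢⱼ yⱼ` between the input and the delayed states. -/
noncomputable def bilinearCoupling {n m p : ℕ} (Aij : Fin m → Fin p → Matrix (Fin n) (Fin n) ℝ)
    (v : Vec m) (y : Fin p → Vec n) : Vec n :=
  ∑ i, ∑ j, v i • Matrix.toEuclideanLin (Aij i j) (y j)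

theorem bilinearCoupling_sub {n m p : ℕ} (Aij : Fin m → Fin p → Matrix (Fin n) (Fin n) ℝ)
    (v : Vec m) (y z : Fin p → Vec n) :
    bilinearCoupling Aij v y - bilinearCoupling Aij v z
      = bilinearCoupling Aij v (fun j => y j - z j) := by
  simp [bilinearCoupling, ← Finset.sum_sub_distrib, ← smul_sub, ← map_sub]

theorem exists_norm_bilinearCoupling_le {n m p : ℕ}
    (Aij : Fin m → Fin p → Matrix (Fin n) (Fin n) ℝ) (B : Matrix (Fin n) (Fin m) ℝ) :
    ∃ c : ℝ, 0 ≤ c ∧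
      (∀ (v : Vec m) (y : Fin p → Vec n) (R : ℝ), (∀ j, ‖y j‖ ≤ R) → 0 ≤ R →
        ‖bilinearCoupling Aij v y‖ ≤ c * ‖v‖ * R) ∧
      ∀ v : Vec m, ‖Matrix.toEuclideanLin B v‖ ≤ c * ‖v‖ := by
  let L := fun i j => LinearMap.toContinuousLinearMap (Matrix.toEuclideanLin (Aij i j))
  let LB := LinearMap.toContinuousLinearMap (Matrix.toEuclideanLin B)
  have hS : 0 ≤ ∑ i, ∑ j, ‖L i j‖ :=
    Finset.sum_nonneg fun i _ => Finset.sum_nonneg fun j _ => norm_nonneg _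
  refine ⟨(∑ i, ∑ j, ‖L i j‖) + ‖LB‖, by positivity, fun v y R hy hR => ?_, fun v => ?_⟩
  · have h1 : ‖bilinearCoupling Aij v y‖ ≤ ∑ i, ∑ j, ‖L i j‖ * ‖v‖ * R := by
      refine norm_sum_le_of_le _ fun i _ => norm_sum_le_of_le _ fun j _ => ?_
      rw [norm_smul]
      calc ‖v i‖ * ‖L i j (y j)‖ ≤ ‖v‖ * (‖L i j‖ * R) := by
            gcongr
            · exact PiLp.norm_apply_le v i
            · exact (L i j).le_of_opNorm_le_of_le le_rfl (hy j)
        _ = _ := by ring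
    simp only [← Finset.sum_mul] at h1
    refine h1.trans ?_
    gcongr
    exact le_add_of_nonneg_right (norm_nonneg _)
  · refine (LB.le_opNorm v).trans ?_
    gcongr
    exact le_add_of_nonneg_left hS

/-- The right-hand side of the bilinear system along a trajectory `x` at time `s`. -/
noncomputable def bilinearRate {n m p : ℕ} (A : Matrix (Fin n) (Fin n) ℝ)
    (Aij : Fin m → Fin p → Matrix (Fin n) (Fin n) ℝ) (B : Matrix (Fin n) (Fin m) ℝ)
    (d : Fin p → ℝ) (u : ℝ → Vec m) (s : ℝ) (x : ℝ → Vec n) : Vec n :=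
  Matrix.toEuclideanLin A (x s) + bilinearCoupling Aij (u s) (fun j => x (s - d j))
    + Matrix.toEuclideanLin B (u s)

/-- The bilinear vector field on history segments. -/
noncomputable def bilinearField (Δ : ℝ≥0) {n m p : ℕ} (A : Matrix (Fin n) (Fin n) ℝ)
    (Aij : Fin m → Fin p → Matrix (Fin n) (Fin n) ℝ) (B : Matrix (Fin n) (Fin m) ℝ)
    (d : Fin p → ℝ) (φ : Hist Δ n) (v : Vec m) : Vec n :=
  Matrix.toEuclideanLin A (ev0 φ)
    + (∑ i : Fin m, ∑ j : Fin p, v i •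
        Matrix.toEuclideanLin (Aij i j)
          (φ (projIcc (-(Δ : ℝ)) 0 (neg_nonpos.mpr Δ.coe_nonneg) (-(d j)))))
    + Matrix.toEuclideanLin B v

section Bilinear

variable {Δ : ℝ≥0} {n m p : ℕ} {A : Matrix (Fin n) (Fin n) ℝ}
  {Aij : Fin m → Fin p → Matrix (Fin n) (Fin n) ℝ} {B : Matrix (Fin n) (Fin m) ℝ}
  {d : Fin p → ℝ} {u : ℝ → Vec m}

theorem bilinearField_seg (hd : ∀ j, d j ∈ Icc (0 : ℝ) (Δ : ℝ)) {x : ℝ → Vec n} {s : ℝ}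
    (hx : ContinuousOn x (Icc (s - (Δ : ℝ)) s)) :
    bilinearField Δ A Aij B d (seg Δ x s) (u s) = bilinearRate A Aij B d u s x := by
  have h : ∀ τ : Icc (-(Δ : ℝ)) (0 : ℝ), seg Δ x s τ = x (s + τ.1) := fun τ => by
    rw [seg, dif_pos hx]; rfl
  have hproj : ∀ j, (projIcc (-(Δ : ℝ)) 0 (neg_nonpos.mpr Δ.coe_nonneg) (-(d j)) : ℝ) = -(d j) :=
    fun j => by
      rw [projIcc_of_mem _ ⟨neg_le_neg (hd j).2, neg_nonpos.2 (hd j).1⟩]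
  simp only [bilinearField, bilinearRate, bilinearCoupling, ev0, h, hproj, add_zero,
    ← sub_eq_add_neg]

theorem bilinearRate_intervalIntegrable (hu : IsInput u) {T : ℝ} (hT : 0 ≤ T) {x : ℝ → Vec n}
    (hx : Continuous x) :
    IntervalIntegrable (fun s => bilinearRate A Aij B d u s x) volume 0 T := by
  have hui := hu.intervalIntegrable hT
  have hlin : ∀ {k : ℕ} (M : Matrix (Fin n) (Fin k) ℝ), Continuous (Matrix.toEuclideanLin M) :=
    fun M => LinearMap.continuous_of_finiteDimensional _
  refine ((((hlin A).comp hx).intervalIntegrable 0 T).add ?_).add ?_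
  · have : (fun s => bilinearCoupling Aij (u s) (fun j => x (s - d j))) = ∑ i, ∑ j, fun s =>
        u s i • Matrix.toEuclideanLin (Aij i j) (x (s - d j)) := by
      ext1 s; simp [bilinearCoupling]
    rw [this]
    refine IntervalIntegrable.sum _ fun i _ => IntervalIntegrable.sum _ fun j _ => ?_
    refine IntervalIntegrable.smul_continuousOn ?_ ?_
    · exact ⟨(EuclideanSpace.proj (𝕜 := ℝ) i).integrable_comp hui.1,
        (EuclideanSpace.proj (𝕜 := ℝ) i).integrable_comp hui.2⟩
    · exact ((hlin _).comp (hx.comp (continuous_id.sub continuous_const))).continuousOn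
  · exact ⟨(LinearMap.toContinuousLinearMap (Matrix.toEuclideanLin B)).integrable_comp hui.1,
      (LinearMap.toContinuousLinearMap (Matrix.toEuclideanLin B)).integrable_comp hui.2⟩

theorem exists_norm_bilinearRate_sub_le (hd : ∀ j, d j ∈ Icc (0 : ℝ) (Δ : ℝ))
    (A : Matrix (Fin n) (Fin n) ℝ) (Aij : Fin m → Fin p → Matrix (Fin n) (Fin n) ℝ)
    (B : Matrix (Fin n) (Fin m) ℝ) :
    ∃ a c : ℝ, 0 ≤ a ∧ 0 ≤ c ∧ ∀ (u : ℝ → Vec m) (s : ℝ) (x y : ℝ → Vec n) (R : ℝ),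
      (∀ τ ∈ Icc (s - (Δ : ℝ)) s, ‖x τ - y τ‖ ≤ R) →
        ‖bilinearRate A Aij B d u s x - bilinearRate A Aij B d u s y‖ ≤ (a + c * ‖u s‖) * R := by
  obtain ⟨c, hc0, hc, -⟩ := exists_norm_bilinearCoupling_le Aij B
  refine ⟨‖LinearMap.toContinuousLinearMap (Matrix.toEuclideanLin A)‖, c, norm_nonneg _, hc0,
    fun u s x y R h => ?_⟩
  have hs := h s ⟨by linarith [Δ.coe_nonneg], le_rfl⟩
  have hR : 0 ≤ R := (norm_nonneg _).trans hs
  have h1 : bilinearRate A Aij B d u s x - bilinearRate A Aij B d u s y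
      = LinearMap.toContinuousLinearMap (Matrix.toEuclideanLin A) (x s - y s)
        + bilinearCoupling Aij (u s) (fun j => x (s - d j) - y (s - d j)) := by
    rw [← bilinearCoupling_sub, map_sub]
    simp only [bilinearRate, LinearMap.coe_toContinuousLinearMap']
    abel
  rw [h1, add_mul]
  refine norm_add_le_of_le (ContinuousLinearMap.le_of_opNorm_le_of_le _ le_rfl hs)
    (hc _ _ _ (fun j => h _ ⟨?_, ?_⟩) hR)
  · linarith [(hd j).2]
  · linarith [(hd j).1]

namespace IsSolution

variable {x₀ : Hist Δ n} {tmax : EReal} {x : ℝ → Vec n}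

theorem continuousOn_Icc (h : IsSolution Δ (bilinearField Δ A Aij B d) u x₀ tmax x) {t : ℝ}
    (htm : (t : EReal) < tmax) : ContinuousOn x (Icc (-(Δ : ℝ)) t) :=
  h.cont.mono fun _ hs => ⟨hs.1, (EReal.coe_le_coe_iff.2 hs.2).trans_lt htm⟩

theorem rate_eqOn (hd : ∀ j, d j ∈ Icc (0 : ℝ) (Δ : ℝ))
    (h : IsSolution Δ (bilinearField Δ A Aij B d) u x₀ tmax x) {t : ℝ}
    (htm : (t : EReal) < tmax) :
    EqOn (fun s => bilinearField Δ A Aij B d (seg Δ x s) (u s))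
      (fun s => bilinearRate A Aij B d u s x) (Icc 0 t) := fun s hs =>
  bilinearField_seg hd ((h.continuousOn_Icc htm).mono
    (Icc_subset_Icc (by linarith [hs.1]) hs.2))

theorem intervalIntegrable_rate (hd : ∀ j, d j ∈ Icc (0 : ℝ) (Δ : ℝ))
    (h : IsSolution Δ (bilinearField Δ A Aij B d) u x₀ tmax x) {t : ℝ} (ht : 0 ≤ t)
    (htm : (t : EReal) < tmax) :
    IntervalIntegrable (fun s => bilinearRate A Aij B d u s x) volume 0 t :=
  (h.integrable t ht htm).congr fun s hs => h.rate_eqOn hd htm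
    (by rw [uIoc_of_le ht] at hs; exact ⟨hs.1.le, hs.2⟩)

theorem eq_add_integral_rate (hd : ∀ j, d j ∈ Icc (0 : ℝ) (Δ : ℝ))
    (h : IsSolution Δ (bilinearField Δ A Aij B d) u x₀ tmax x) {t : ℝ} (ht : 0 ≤ t)
    (htm : (t : EReal) < tmax) :
    x t = x 0 + ∫ s in (0 : ℝ)..t, bilinearRate A Aij B d u s x := by
  rw [h.integral_eq t ht htm, intervalIntegral.integral_congr]
  rw [uIcc_of_le ht]
  exact h.rate_eqOn hd htm

end IsSolution

/-! ### Uniqueness and global existence of solutions -/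

theorem intervalIntegral_le_of_le_of_nonneg {k : ℝ → ℝ} {T : ℝ}
    (hk : IntervalIntegrable k volume 0 T) (hk0 : ∀ s, 0 ≤ k s) {s t : ℝ} (hs : 0 ≤ s)
    (hst : s ≤ t) (ht : t ≤ T) : ∫ v in (0 : ℝ)..s, k v ≤ ∫ v in (0 : ℝ)..t, k v :=
  intervalIntegral.integral_mono_interval le_rfl hs hst (Eventually.of_forall hk0)
    (hk.mono_set (uIcc_subset_uIcc left_mem_uIcc
      (by rw [uIcc_of_le (hs.trans (hst.trans ht))]; exact ⟨hs.trans hst, ht⟩)))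

theorem IsSolution.eq_of_lt (hd : ∀ j, d j ∈ Icc (0 : ℝ) (Δ : ℝ)) (hu : IsInput u)
    {x₀ : Hist Δ n} {tmax tmax' : EReal} {x x' : ℝ → Vec n}
    (h : IsSolution Δ (bilinearField Δ A Aij B d) u x₀ tmax x)
    (h' : IsSolution Δ (bilinearField Δ A Aij B d) u x₀ tmax' x') {t : ℝ}
    (ht : -(Δ : ℝ) ≤ t) (htm : (t : EReal) < tmax) (htm' : (t : EReal) < tmax') :
    x t = x' t := by
  have hinit : ∀ τ ∈ Icc (-(Δ : ℝ)) 0, x τ = x' τ := fun τ hτ =>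
    (h.init ⟨τ, hτ⟩).trans (h'.init ⟨τ, hτ⟩).symm
  rcases le_total t 0 with ht0 | ht0
  · exact hinit t ⟨ht, ht0⟩
  obtain ⟨a, c, ha, hc, hL⟩ := exists_norm_bilinearRate_sub_le (d := d) hd A Aij B
  have hk : IntervalIntegrable (fun s => a + c * ‖u s‖) volume 0 t :=
    intervalIntegrable_const.add ((hu.intervalIntegrable ht0).norm.const_mul c)
  have hk0 : ∀ s, 0 ≤ a + c * ‖u s‖ := fun s => by positivity
  have hcont := (h.continuousOn_Icc htm).mono
    (Icc_subset_Icc_left (by linarith [Δ.coe_nonneg]) : Icc 0 t ⊆ _)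
  have hcont' := (h'.continuousOn_Icc htm').mono
    (Icc_subset_Icc_left (by linarith [Δ.coe_nonneg]) : Icc 0 t ⊆ _)
  have key : ‖x t - x' t‖ ≤ 0 * Real.exp (∫ v in (0 : ℝ)..t, (a + c * ‖u v‖)) := by
    refine gronwall_of_running_bound (m := fun s => ‖x s - x' s‖) hk (hcont.sub hcont').norm
      (fun s hs M hM hrun => ?_) ⟨ht0, le_rfl⟩
    have hsm : (s : EReal) < tmax := (EReal.coe_le_coe_iff.2 hs.2).trans_lt htm
    have hsm' : (s : EReal) < tmax' := (EReal.coe_le_coe_iff.2 hs.2).trans_lt htm'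
    have hsub : uIcc 0 s ⊆ uIcc 0 t :=
      uIcc_subset_uIcc left_mem_uIcc (by rw [uIcc_of_le ht0]; exact hs)
    have h0 : x 0 = x' 0 := hinit 0 (zero_mem_IccD Δ)
    have h1 : x s - x' s = ∫ σ in (0 : ℝ)..s,
        (bilinearRate A Aij B d u σ x - bilinearRate A Aij B d u σ x') := by
      rw [intervalIntegral.integral_sub (h.intervalIntegrable_rate hd hs.1 hsm)
        (h'.intervalIntegrable_rate hd hs.1 hsm'), h.eq_add_integral_rate hd hs.1 hsm,
        h'.eq_add_integral_rate hd hs.1 hsm', h0]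
      abel
    rw [zero_add]
    change ‖x s - x' s‖ ≤ _
    rw [h1]
    refine intervalIntegral.norm_integral_le_of_norm_le hs.1
      (Eventually.of_forall fun σ hσ => hL u σ x x' _ fun τ hτ => ?_) ?_
    · rcases le_total τ 0 with hτ0 | hτ0
      · rw [hinit τ ⟨by linarith [hτ.1, hσ.1], hτ0⟩, sub_self, norm_zero]
        positivity
      · refine (hrun τ ⟨hτ0, hτ.2.trans hσ.2⟩).trans ?_
        gcongr
        exact intervalIntegral_le_of_le_of_nonneg hk hk0 hτ0 hτ.2 (hσ.2.trans hs.2)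
    · refine (hk.mono_set hsub).mul_continuousOn (continuousOn_const.mul
        (Real.continuous_exp.comp_continuousOn ?_))
      exact (intervalIntegral.continuousOn_primitive_interval' hk left_mem_uIcc).mono hsub
  rw [zero_mul] at key
  exact sub_eq_zero.1 (norm_le_zero_iff.1 key)

theorem exists_isSolution (hd : ∀ j, d j ∈ Icc (0 : ℝ) (Δ : ℝ)) (hu : IsInput u)
    (x₀ : Hist Δ n) {T : ℝ} (hT : 0 < T) :
    ∃ x, IsSolution Δ (bilinearField Δ A Aij B d) u x₀ T x := by
  obtain ⟨a, c, ha, hc, hL⟩ := exists_norm_bilinearRate_sub_le (d := d) hd A Aij B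
  obtain ⟨x, hx, hx0, hxT⟩ := exists_causal_integral_eq hT.le
    (F := bilinearRate A Aij B d u) (k := fun s => a + c * ‖u s‖)
    (intervalIntegrable_const.add ((hu.intervalIntegrable hT.le).norm.const_mul c))
    (fun s => by positivity)
    (fun x hx => bilinearRate_intervalIntegrable hu hT.le hx)
    (fun s _ x y R hR => hL u s x y R fun τ hτ => hR τ hτ.2)
    (x₀ := fun τ => x₀ (projIcc (-(Δ : ℝ)) 0 (neg_nonpos.mpr Δ.coe_nonneg) τ))
    (x₀.continuous.comp continuous_projIcc)
  have hrate : (fun s => bilinearField Δ A Aij B d (seg Δ x s) (u s))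
      = fun s => bilinearRate A Aij B d u s x :=
    funext fun s => bilinearField_seg hd hx.continuousOn
  refine ⟨x, by exact_mod_cast hT, hx.continuousOn, fun τ => ?_, fun t ht _ => ?_,
    fun t ht htT => ?_⟩
  · rw [hx0 τ τ.2.2, projIcc_of_mem _ τ.2]
  · rw [hrate]
    exact bilinearRate_intervalIntegrable hu ht hx
  · rw [hrate]
    exact hxT t ⟨ht, (EReal.coe_lt_coe_iff.1 htT).le⟩

theorem IsMaxSolution.tmax_eq_top (hd : ∀ j, d j ∈ Icc (0 : ℝ) (Δ : ℝ)) (hu : IsInput u)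
    {x₀ : Hist Δ n} {tmax : EReal} {x : ℝ → Vec n}
    (h : IsMaxSolution Δ (bilinearField Δ A Aij B d) u x₀ tmax x) : tmax = ⊤ := by
  induction tmax with
  | bot => exact absurd h.1.tmax_pos (by simp)
  | top => rfl
  | coe T₀ =>
    have hT₀ : 0 < T₀ := by exact_mod_cast h.1.tmax_pos
    obtain ⟨x', hx'⟩ := exists_isSolution (A := A) (Aij := Aij) (B := B) hd hu x₀
      (add_pos hT₀ one_pos)
    have hle := h.2 _ x' hx' fun t ht htm => hx'.eq_of_lt hd hu h.1 ht
      (htm.trans (EReal.coe_lt_coe_iff.2 (lt_add_one T₀))) htm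
    exact absurd (EReal.coe_le_coe_iff.1 hle) (by linarith)

/-! ### The integral input-to-state estimate -/

theorem norm_le_of_exp_decay (hd : ∀ j, d j ∈ Icc (0 : ℝ) (Δ : ℝ)) (hu : IsInput u)
    {K lam c : ℝ} (hK : 1 ≤ K) (hlam : 0 < lam) (hc0 : 0 ≤ c)
    (hexp : ∀ t : ℝ, 0 ≤ t → ‖NormedSpace.exp
      (t • LinearMap.toContinuousLinearMap (Matrix.toEuclideanLin A))‖
        ≤ K * Real.exp (-lam * t))
    (hc : ∀ (v : Vec m) (y : Fin p → Vec n) (R : ℝ), (∀ j, ‖y j‖ ≤ R) → 0 ≤ R →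
        ‖bilinearCoupling Aij v y‖ ≤ c * ‖v‖ * R)
    (hcB : ∀ v : Vec m, ‖Matrix.toEuclideanLin B v‖ ≤ c * ‖v‖)
    {x₀ : Hist Δ n} {tmax : EReal} {x : ℝ → Vec n}
    (h : IsSolution Δ (bilinearField Δ A Aij B d) u x₀ tmax x) {T : ℝ} (hT : 0 ≤ T)
    (hTm : (T : EReal) < tmax) :
    ‖x T‖ ≤ (K * ‖x₀‖ * Real.exp (-lam * T) + K * c * ∫ s in (0 : ℝ)..T, ‖u s‖)
      * Real.exp (K * c * Real.exp (lam * Δ) * ∫ s in (0 : ℝ)..T, ‖u s‖) := by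
  set 𝒜 := LinearMap.toContinuousLinearMap (Matrix.toEuclideanLin A) with h𝒜
  set r := ‖x₀‖ with hr
  have hΔ : (0 : ℝ) ≤ Δ := Δ.coe_nonneg
  have hr0 : 0 ≤ r := norm_nonneg _
  have hinit : ∀ τ ∈ Icc (-(Δ : ℝ)) 0, ‖x τ‖ ≤ r := fun τ hτ => by
    rw [h.init ⟨τ, hτ⟩]
    exact x₀.norm_coe_le_norm _
  have hun : IntervalIntegrable (fun s => ‖u s‖) volume 0 T := (hu.intervalIntegrable hT).norm
  have hcont : ContinuousOn x (Icc 0 T) :=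
    (h.continuousOn_Icc hTm).mono (Icc_subset_Icc_left (by linarith))
  have hsub : ∀ t ∈ Icc 0 T, uIcc 0 t ⊆ uIcc 0 T := fun t ht =>
    uIcc_subset_uIcc left_mem_uIcc (by rw [uIcc_of_le hT]; exact ht)
  -- the forcing term of the linear equation
  let g : ℝ → Vec n := fun s =>
    bilinearCoupling Aij (u s) (fun j => x (s - d j)) + Matrix.toEuclideanLin B (u s)
  have hrate : ∀ s, bilinearRate A Aij B d u s x = 𝒜 (x s) + g s := fun s => by
    simp only [bilinearRate, g, h𝒜, LinearMap.coe_toContinuousLinearMap', add_assoc]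
  have hg : IntervalIntegrable g volume 0 T := by
    have h1 : IntervalIntegrable (fun s => 𝒜 (x s)) volume 0 T :=
      ContinuousOn.intervalIntegrable (by
        rw [uIcc_of_le hT]; exact 𝒜.continuous.comp_continuousOn hcont)
    refine ((h.intervalIntegrable_rate hd hT hTm).sub h1).congr fun s _ => ?_
    simp only [hrate, add_sub_cancel_left]
  have hduhamel : ∀ t ∈ Icc 0 T, x t = NormedSpace.exp (t • 𝒜) (x 0)
      + ∫ s in (0 : ℝ)..t, NormedSpace.exp ((t - s) • 𝒜) (g s) := fun t ht => by
    have hP : ∀ s, HasDerivAt (fun s : ℝ => NormedSpace.exp ((t - s) • 𝒜))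
        (-(NormedSpace.exp ((t - s) • 𝒜) ∘L 𝒜)) s := fun s => by
      have := (hasDerivAt_exp_smul_const (𝕂 := ℝ) 𝒜 (t - s)).scomp s
        ((hasDerivAt_id s).const_sub t)
      rw [neg_smul, one_smul] at this
      exact this
    have := variation_of_constants ht.1 hP (X := x) (g := g)
      (hcont.mono (Icc_subset_Icc_right ht.2)) (hg.mono_set (hsub t ht)) fun s hs => by
        simp_rw [← hrate]
        exact h.eq_add_integral_rate hd hs.1
          ((EReal.coe_le_coe_iff.2 (hs.2.trans ht.2)).trans_lt hTm)
    have h0 : (t - t) • 𝒜 = 0 := by rw [sub_self]; exact zero_smul ℝ 𝒜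
    rw [h0, NormedSpace.exp_zero, sub_zero] at this
    exact this
  set C := K * c * Real.exp (lam * Δ) with hC
  have hC0 : 0 ≤ C := by positivity
  set w : ℝ → ℝ := fun s => K * c * Real.exp (lam * s) * ‖u s‖ with hw
  have hwi : IntervalIntegrable w volume 0 T := by
    refine hun.continuousOn_mul ?_
    fun_prop
  have hw0 : ∀ s, 0 ≤ w s := fun s => by positivity
  set N := K * r + ∫ s in (0 : ℝ)..T, w s with hN
  have hNr : r ≤ N := by
    have : 0 ≤ ∫ s in (0 : ℝ)..T, w s := intervalIntegral.integral_nonneg hT fun s _ => hw0 s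
    nlinarith
  have hk : IntervalIntegrable (fun s => C * ‖u s‖) volume 0 T := hun.const_mul C
  have hk0 : ∀ s, 0 ≤ C * ‖u s‖ := fun s => by positivity
  have key : Real.exp (lam * T) * ‖x T‖ ≤ N * Real.exp (∫ v in (0 : ℝ)..T, C * ‖u v‖) := by
    refine gronwall_of_running_bound (m := fun s => Real.exp (lam * s) * ‖x s‖) hk
      (ContinuousOn.mul (by fun_prop) hcont.norm) (fun t ht M hM hrun => ?_) ⟨hT, le_rfl⟩
    have hM0 : 0 ≤ M := hr0.trans (hNr.trans hM)
    have hkt := hk.mono_set (hsub t ht)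
    have hwt := hwi.mono_set (hsub t ht)
    -- bounds on the delayed states and on the forcing term
    have hdelay : ∀ s ∈ Icc 0 t, ∀ τ ∈ Icc (s - (Δ : ℝ)) s,
        ‖x τ‖ ≤ Real.exp (lam * Δ) * Real.exp (-(lam * s))
          * (M * Real.exp (∫ v in (0 : ℝ)..s, C * ‖u v‖)) := fun s hs τ hτ => by
      rw [← Real.exp_add]
      have hle : Real.exp (-(lam * τ)) ≤ Real.exp (lam * Δ + -(lam * s)) := by
        rw [Real.exp_le_exp]; nlinarith [hτ.1]
      refine le_trans ?_ (mul_le_mul_of_nonneg_right hle (by positivity))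
      rcases le_total τ 0 with hτ0 | hτ0
      · have h1 : 1 ≤ Real.exp (-(lam * τ)) := Real.one_le_exp (by nlinarith)
        have h2 : 1 ≤ Real.exp (∫ v in (0 : ℝ)..s, C * ‖u v‖) :=
          Real.one_le_exp (intervalIntegral.integral_nonneg hs.1 fun v _ => hk0 v)
        have h3 : ‖x τ‖ ≤ M :=
          (hinit τ ⟨by linarith [hτ.1, hs.1], hτ0⟩).trans (hNr.trans hM)
        calc ‖x τ‖ ≤ 1 * (M * 1) := by linarith
          _ ≤ _ := by gcongr
      · have h1 := hrun τ ⟨hτ0, hτ.2.trans hs.2⟩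
        have h2 := intervalIntegral_le_of_le_of_nonneg hk hk0 hτ0 hτ.2 (hs.2.trans ht.2)
        calc ‖x τ‖ = Real.exp (-(lam * τ)) * (Real.exp (lam * τ) * ‖x τ‖) := by
              rw [← mul_assoc, ← Real.exp_add]; simp
          _ ≤ Real.exp (-(lam * τ)) * (M * Real.exp (∫ v in (0 : ℝ)..τ, C * ‖u v‖)) := by
              gcongr
          _ ≤ _ := by gcongr
    have hgs : ∀ s ∈ Ioc 0 t, ‖NormedSpace.exp ((t - s) • 𝒜) (g s)‖ ≤
        Real.exp (-(lam * t)) * (C * ‖u s‖ * (M * Real.exp (∫ v in (0 : ℝ)..s, C * ‖u v‖))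
          + w s) := fun s hs => by
      have hs' : s ∈ Icc 0 t := ⟨hs.1.le, hs.2⟩
      have h1 : ‖g s‖ ≤ c * ‖u s‖ * (Real.exp (lam * Δ) * Real.exp (-(lam * s))
          * (M * Real.exp (∫ v in (0 : ℝ)..s, C * ‖u v‖))) + c * ‖u s‖ :=
        norm_add_le_of_le (hc _ _ _ (fun j => hdelay s hs' _
          ⟨by linarith [(hd j).2], by linarith [(hd j).1]⟩) (by positivity)) (hcB _)
      refine ((NormedSpace.exp ((t - s) • 𝒜)).le_of_opNorm_le_of_le
        (hexp _ (sub_nonneg.2 hs.2)) h1).trans (le_of_eq ?_)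
      have h2 : Real.exp (-lam * (t - s)) = Real.exp (-(lam * t)) * Real.exp (lam * s) := by
        rw [← Real.exp_add]; ring_nf
      have h3 : Real.exp (lam * s) * Real.exp (-(lam * s)) = 1 := by
        rw [← Real.exp_add]; simp
      rw [h2]
      simp only [hw, hC]
      linear_combination (Real.exp (-(lam * t)) * K * c * ‖u s‖ * Real.exp (lam * Δ)
        * (M * Real.exp (∫ v in (0 : ℝ)..s, K * c * Real.exp (lam * Δ) * ‖u v‖))) * h3
    have hki : IntervalIntegrable
        (fun s => C * ‖u s‖ * (M * Real.exp (∫ v in (0 : ℝ)..s, C * ‖u v‖))) volume 0 t :=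
      hkt.mul_continuousOn (continuousOn_const.mul (Real.continuous_exp.comp_continuousOn
        ((intervalIntegral.continuousOn_primitive_interval' hk left_mem_uIcc).mono (hsub t ht))))
    have hint := intervalIntegral.norm_integral_le_of_norm_le ht.1
      (Eventually.of_forall hgs) ((hki.add hwt).const_mul (Real.exp (-(lam * t))))
    rw [intervalIntegral.integral_const_mul, intervalIntegral.integral_add hki hwt] at hint
    have hx0 : ‖NormedSpace.exp (t • 𝒜) (x 0)‖ ≤ K * Real.exp (-lam * t) * r :=
      (NormedSpace.exp (t • 𝒜)).le_of_opNorm_le_of_le (hexp t ht.1)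
        (hinit 0 (zero_mem_IccD Δ))
    have hxt := norm_add_le_of_le hx0 hint
    rw [← hduhamel t ht] at hxt
    have hwT := intervalIntegral_le_of_le_of_nonneg hwi hw0 ht.1 ht.2 le_rfl
    have h3 : Real.exp (lam * t) * Real.exp (-(lam * t)) = 1 := by
      rw [← Real.exp_add]; simp
    change Real.exp (lam * t) * ‖x t‖ ≤ _
    refine (mul_le_mul_of_nonneg_left hxt (Real.exp_pos _).le).trans ?_
    rw [neg_mul, hN]
    refine le_trans (le_of_eq ?_) (add_le_add_left (add_le_add_right hwT (K * r)) _)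
    linear_combination (K * r + ((∫ s in (0 : ℝ)..t,
      C * ‖u s‖ * (M * Real.exp (∫ v in (0 : ℝ)..s, C * ‖u v‖)))
        + ∫ s in (0 : ℝ)..t, w s)) * h3
  rw [intervalIntegral.integral_const_mul] at key
  have hwle : ∫ s in (0 : ℝ)..T, w s ≤ K * c * Real.exp (lam * T) * ∫ s in (0 : ℝ)..T, ‖u s‖ := by
    rw [← intervalIntegral.integral_const_mul]
    refine intervalIntegral.integral_mono_on hT hwi (hun.const_mul _) fun s hs => ?_
    simp only [hw]
    gcongr
    exact hs.2
  have h3 : Real.exp (-lam * T) * Real.exp (lam * T) = 1 := by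
    rw [← Real.exp_add]; simp
  calc ‖x T‖ = Real.exp (-lam * T) * (Real.exp (lam * T) * ‖x T‖) := by
        rw [← mul_assoc, h3, one_mul]
    _ ≤ Real.exp (-lam * T) * ((K * r + K * c * Real.exp (lam * T) * ∫ s in (0 : ℝ)..T, ‖u s‖)
          * Real.exp (C * ∫ s in (0 : ℝ)..T, ‖u s‖)) := by
        refine mul_le_mul_of_nonneg_left (key.trans ?_) (Real.exp_pos _).le
        exact mul_le_mul_of_nonneg_right (by linarith) (Real.exp_pos _).le
    _ = _ := by
        linear_combination (K * c * (∫ s in (0 : ℝ)..T, ‖u s‖)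
          * Real.exp (C * ∫ s in (0 : ℝ)..T, ‖u s‖)) * h3

end Bilinear

/-! ### Complexification -/

/-- The inclusion `ℝⁿ → ℂⁿ`. -/
noncomputable def euclideanOfReal (n : ℕ) : Vec n →ₗᵢ[ℝ] EuclideanSpace ℂ (Fin n) where
  toFun v := WithLp.toLp 2 fun i => (v i : ℂ)
  map_add' v w := by ext i; simp
  map_smul' a v := by ext i; simp
  norm_map' v := by simp [EuclideanSpace.norm_eq]

/-- The coordinatewise real part `ℂⁿ → ℝⁿ`. -/
noncomputable def euclideanRe (n : ℕ) : EuclideanSpace ℂ (Fin n) →L[ℝ] Vec n :=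
  LinearMap.toContinuousLinearMap
    { toFun := fun v => WithLp.toLp 2 fun i => (v i).re
      map_add' := fun v w => by ext i; simp
      map_smul' := fun a v => by ext i; simp }

theorem euclideanRe_apply {n : ℕ} (v : EuclideanSpace ℂ (Fin n)) (i : Fin n) :
    euclideanRe n v i = (v i).re := rfl

theorem euclideanOfReal_apply {n : ℕ} (v : Vec n) (i : Fin n) :
    euclideanOfReal n v i = (v i : ℂ) := rfl

theorem eq_euclideanOfReal_re_add {n : ℕ} (v : EuclideanSpace ℂ (Fin n)) :
    v = euclideanOfReal n (euclideanRe n v)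
      + Complex.I • euclideanOfReal n (euclideanRe n (-Complex.I • v)) := by
  ext i
  apply Complex.ext <;> simp [euclideanRe_apply, euclideanOfReal_apply]

theorem euclideanOfReal_toEuclideanLin {n : ℕ} (A : Matrix (Fin n) (Fin n) ℝ) (v : Vec n) :
    euclideanOfReal n (Matrix.toEuclideanLin A v)
      = Matrix.toEuclideanLin (A.map (algebraMap ℝ ℂ)) (euclideanOfReal n v) := by
  ext i
  simp [euclideanOfReal_apply, Matrix.toLpLin_apply, Matrix.mulVec, dotProduct]

theorem euclideanRe_toEuclideanLin {n : ℕ} (A : Matrix (Fin n) (Fin n) ℝ)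
    (v : EuclideanSpace ℂ (Fin n)) :
    euclideanRe n (Matrix.toEuclideanLin (A.map (algebraMap ℝ ℂ)) v)
      = Matrix.toEuclideanLin A (euclideanRe n v) := by
  ext i
  simp [euclideanRe_apply, Matrix.toLpLin_apply, Matrix.mulVec, dotProduct]

theorem map_exp_of_semiconj {E E' : Type*} [NormedAddCommGroup E] [NormedSpace ℝ E]
    [CompleteSpace E] [NormedAddCommGroup E'] [NormedSpace ℂ E'] [CompleteSpace E']
    (ι : E →L[ℝ] E') {a : E →L[ℝ] E} {b : E' →L[ℂ] E'} (h : ∀ v, ι (a v) = b (ι v)) (v : E) :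
    ι (NormedSpace.exp a v) = NormedSpace.exp b (ι v) := by
  have hpow : ∀ k : ℕ, ι ((a ^ k) v) = (b ^ k) (ι v) := fun k => by
    induction k with
    | zero => simp
    | succ k ih => rw [pow_succ', pow_succ', mul_apply_eq_comp, mul_apply_eq_comp, h, ih]
  have h1 := (NormedSpace.exp_series_hasSum_exp' (𝕂 := ℝ) a).mapL
    (ι ∘L ContinuousLinearMap.apply ℝ E v)
  have h2 := (NormedSpace.exp_series_hasSum_exp' (𝕂 := ℝ) b).mapL
    ((ContinuousLinearMap.apply ℂ E' (ι v)).restrictScalars ℝ)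
  have hterm : ∀ k : ℕ, ι (((k.factorial : ℝ)⁻¹ • a ^ k) v)
      = ((k.factorial : ℝ)⁻¹ • b ^ k) (ι v) := fun k => by
    rw [smul_apply, map_smul, hpow, smul_apply]
  exact h1.unique ((funext hterm :) ▸ h2)

theorem mem_spectrum_iff_exists_toEuclideanLin {n : ℕ} {M : Matrix (Fin n) (Fin n) ℂ} {μ : ℂ} :
    μ ∈ spectrum ℂ M ↔ ∃ v, v ≠ 0 ∧ Matrix.toEuclideanLin M v = μ • v := by
  rw [← Matrix.spectrum_toLpLin 2, ← Module.End.hasEigenvalue_iff_mem_spectrum]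
  refine ⟨fun h => ?_, fun ⟨v, hv, hMv⟩ => ?_⟩
  · obtain ⟨v, hv⟩ := h.exists_hasEigenvector
    exact ⟨v, hv.2, hv.apply_eq_smul⟩
  · exact Module.End.hasEigenvalue_of_hasEigenvector
      ⟨Module.End.mem_eigenspace_iff.2 hMv, hv⟩

theorem exists_norm_exp_toEuclideanLin_le {n : ℕ} {A : Matrix (Fin n) (Fin n) ℝ}
    (h : ∀ μ ∈ spectrum ℂ (A.map (algebraMap ℝ ℂ)), μ.re < 0) :
    ∃ K lam : ℝ, 1 ≤ K ∧ 0 < lam ∧ ∀ t : ℝ, 0 ≤ t →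
      ‖NormedSpace.exp (t • LinearMap.toContinuousLinearMap (Matrix.toEuclideanLin A))‖
        ≤ K * Real.exp (-lam * t) := by
  obtain ⟨K, lam, hK, hlam, hexp⟩ := exists_norm_exp_smul_le
    (𝒜 := LinearMap.toContinuousLinearMap (Matrix.toEuclideanLin (A.map (algebraMap ℝ ℂ))))
    fun μ v hv hμ => h μ (mem_spectrum_iff_exists_toEuclideanLin.2 ⟨v, hv, hμ⟩)
  refine ⟨K, lam, hK, hlam, fun t ht =>
    ContinuousLinearMap.opNorm_le_bound _ (by positivity) fun v => ?_⟩
  rw [← (euclideanOfReal n).norm_map, ← (euclideanOfReal n).norm_map v]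
  have := map_exp_of_semiconj (euclideanOfReal n).toContinuousLinearMap
    (a := t • LinearMap.toContinuousLinearMap (Matrix.toEuclideanLin A))
    (b := t • LinearMap.toContinuousLinearMap (Matrix.toEuclideanLin (A.map (algebraMap ℝ ℂ))))
    (fun v => by simp [euclideanOfReal_toEuclideanLin]) v
  change euclideanOfReal n _ = _ at this
  rw [this]
  exact ContinuousLinearMap.le_of_opNorm_le _ (hexp t ht) _

/-! ### Necessity of the Hurwitz property -/

theorem tendsto_euclideanRe_of_iISS {Δ : ℝ≥0} {n m p : ℕ} {A : Matrix (Fin n) (Fin n) ℝ}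
    {Aij : Fin m → Fin p → Matrix (Fin n) (Fin n) ℝ} {B : Matrix (Fin n) (Fin m) ℝ}
    {d : Fin p → ℝ} (hd : ∀ j, d j ∈ Icc (0 : ℝ) (Δ : ℝ))
    (h : iISS Δ (bilinearField Δ A Aij B d)) {μ : ℂ} {v : EuclideanSpace ℂ (Fin n)}
    (hv : Matrix.toEuclideanLin (A.map (algebraMap ℝ ℂ)) v = μ • v) :
    Tendsto (fun t : ℝ => euclideanRe n (Complex.exp (t * μ) • v)) atTop (𝓝 0) := by
  obtain ⟨β, η, γ, hβ, hη, hγ, hest⟩ := h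
  let x : ℝ → Vec n := fun t => euclideanRe n (Complex.exp (t * μ) • v)
  have hderiv : ∀ t, HasDerivAt x (Matrix.toEuclideanLin A (x t)) t := fun t => by
    have h1 : HasDerivAt (fun t : ℝ => Complex.exp (t * μ)) (Complex.exp (t * μ) * μ) t := by
      simpa using ((hasDerivAt_id t).ofReal_comp.mul_const μ).cexp
    have h2 := (euclideanRe n).hasFDerivAt.comp_hasDerivAt t (h1.smul_const v)
    rw [mul_smul, ← hv, ← map_smul, euclideanRe_toEuclideanLin] at h2
    exact h2
  have hx : Continuous x := continuous_iff_continuousAt.2 fun t => (hderiv t).continuousAt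
  have hlin : Continuous (Matrix.toEuclideanLin A) :=
    LinearMap.continuous_of_finiteDimensional _
  have hrate : (fun s => bilinearField Δ A Aij B d (seg Δ x s) 0)
      = fun s => Matrix.toEuclideanLin A (x s) := by
    ext1 s
    refine (bilinearField_seg (u := fun _ => 0) hd hx.continuousOn).trans ?_
    simp [bilinearRate, bilinearCoupling]
  have hu : IsInput (fun _ => 0 : ℝ → Vec m) :=
    ⟨measurable_const, fun _ _ => ⟨0, Eventually.of_forall fun _ _ => by simp⟩⟩
  let x₀ : Hist Δ n := ⟨fun τ => x τ, hx.comp continuous_subtype_val⟩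
  have hsol : IsSolution Δ (bilinearField Δ A Aij B d) (fun _ => 0) x₀ ⊤ x :=
    { tmax_pos := EReal.zero_lt_top
      cont := hx.continuousOn
      init := fun _ => rfl
      integrable := fun t _ _ => by
        rw [hrate]
        exact (hlin.comp hx).intervalIntegrable 0 t
      integral_eq := fun t _ _ => by
        rw [hrate, intervalIntegral.integral_eq_sub_of_hasDerivAt (fun s _ => hderiv s)
          ((hlin.comp hx).intervalIntegrable 0 t)]
        abel }
  have hbound := (hest x₀ _ ⊤ x hu ⟨hsol, fun _ _ _ _ => le_top⟩).2
  refine squeeze_zero_norm' ?_ (hβ.2 ‖x₀‖ (norm_nonneg _)).2.2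
  filter_upwards [eventually_ge_atTop 0] with t ht
  simpa [hγ.2.2, hη.2.2] using hbound t ht

theorem re_neg_of_iISS {Δ : ℝ≥0} {n m p : ℕ} {A : Matrix (Fin n) (Fin n) ℝ}
    {Aij : Fin m → Fin p → Matrix (Fin n) (Fin n) ℝ} {B : Matrix (Fin n) (Fin m) ℝ}
    {d : Fin p → ℝ} (hd : ∀ j, d j ∈ Icc (0 : ℝ) (Δ : ℝ))
    (h : iISS Δ (bilinearField Δ A Aij B d)) {μ : ℂ}
    (hμ : μ ∈ spectrum ℂ (A.map (algebraMap ℝ ℂ))) : μ.re < 0 := by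
  obtain ⟨v, hv0, hv⟩ := mem_spectrum_iff_exists_toEuclideanLin.1 hμ
  by_contra! hre
  have h1 := tendsto_euclideanRe_of_iISS hd h hv
  have h2 := tendsto_euclideanRe_of_iISS hd h (v := -Complex.I • v)
    (by rw [map_smul, hv, smul_comm])
  have hι := (euclideanOfReal n).continuous
  have h3 : Tendsto (fun t : ℝ => Complex.exp (t * μ) • v) atTop (𝓝 0) := by
    have h4 := ((hι.tendsto 0).comp h1).add
      (((hι.tendsto 0).comp h2).const_smul Complex.I)
    simp only [map_zero, smul_zero, add_zero] at h4
    refine h4.congr fun t => ?_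
    conv_rhs => rw [eq_euclideanOfReal_re_add (Complex.exp (t * μ) • v)]
    simp only [Function.comp_apply]
    rw [smul_comm (-Complex.I)]
  have h5 : ‖v‖ ≤ 0 := by
    refine ge_of_tendsto (by simpa using h3.norm) ?_
    filter_upwards [eventually_ge_atTop 0] with t ht
    rw [norm_smul, Complex.norm_exp]
    refine le_mul_of_one_le_left (norm_nonneg _) (Real.one_le_exp ?_)
    simpa using mul_nonneg ht hre
  exact hv0 (norm_le_zero_iff.1 h5)

/-! ### Sufficiency of the Hurwitz property -/

theorem classKL_exp_add_sq {K lam : ℝ} (hK : 0 < K) (hlam : 0 < lam) :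
    ClassKL fun s t => K * s * Real.exp (-lam * t) + (K * s * Real.exp (-lam * t)) ^ 2 / 2 := by
  refine ⟨fun t _ => ⟨by fun_prop, fun a ha b hb hab => ?_, by simp⟩,
    fun s hs => ⟨by fun_prop, fun a _ b _ hab => ?_, ?_⟩⟩
  · have ha' : 0 ≤ a := ha
    have : K * a * Real.exp (-lam * t) < K * b * Real.exp (-lam * t) := by gcongr
    have h0 : 0 ≤ K * a * Real.exp (-lam * t) := by positivity
    change K * a * Real.exp (-lam * t) + (K * a * Real.exp (-lam * t)) ^ 2 / 2
      < K * b * Real.exp (-lam * t) + (K * b * Real.exp (-lam * t)) ^ 2 / 2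
    gcongr
  · have hexp : Real.exp (-lam * b) ≤ Real.exp (-lam * a) := by
      rw [Real.exp_le_exp]; nlinarith
    change K * s * Real.exp (-lam * b) + (K * s * Real.exp (-lam * b)) ^ 2 / 2
      ≤ K * s * Real.exp (-lam * a) + (K * s * Real.exp (-lam * a)) ^ 2 / 2
    gcongr
  · have h1 : Tendsto (fun t => Real.exp (-lam * t)) atTop (𝓝 0) :=
      Real.tendsto_exp_atBot.comp (tendsto_id.const_mul_atTop_of_neg (neg_neg_of_pos hlam))
    have h2 := h1.const_mul (K * s)
    simpa using h2.add ((h2.pow 2).div_const 2)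

theorem classN_exp_sub_one_sq_add {b C : ℝ} (hb : 0 ≤ b) (hC : 0 ≤ C) :
    ClassN fun s => (Real.exp (C * s) - 1) ^ 2 / 2 + b * s * Real.exp (C * s) := by
  refine ⟨by fun_prop, fun s hs t ht hst => ?_, by simp⟩
  have hs' : 0 ≤ s := hs
  have h1 : 0 ≤ Real.exp (C * s) - 1 := sub_nonneg.2 (Real.one_le_exp (by positivity))
  change (Real.exp (C * s) - 1) ^ 2 / 2 + b * s * Real.exp (C * s)
    ≤ (Real.exp (C * t) - 1) ^ 2 / 2 + b * t * Real.exp (C * t)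
  have ht' : 0 ≤ t := ht
  gcongr

theorem iISS_of_hurwitz {Δ : ℝ≥0} {n m p : ℕ} {A : Matrix (Fin n) (Fin n) ℝ}
    (Aij : Fin m → Fin p → Matrix (Fin n) (Fin n) ℝ) (B : Matrix (Fin n) (Fin m) ℝ)
    {d : Fin p → ℝ} (hd : ∀ j, d j ∈ Icc (0 : ℝ) (Δ : ℝ))
    (h : ∀ μ ∈ spectrum ℂ (A.map (algebraMap ℝ ℂ)), μ.re < 0) :
    iISS Δ (bilinearField Δ A Aij B d) := by
  obtain ⟨K, lam, hK, hlam, hexp⟩ := exists_norm_exp_toEuclideanLin_le h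
  obtain ⟨c, hc0, hc, hcB⟩ := exists_norm_bilinearCoupling_le Aij B
  have hK0 : 0 < K := one_pos.trans_le hK
  refine ⟨_, _, id, classKL_exp_add_sq hK0 hlam,
    classN_exp_sub_one_sq_add (b := K * c) (C := K * c * Real.exp (lam * Δ))
      (by positivity) (by positivity),
    ⟨continuousOn_id, monotoneOn_id, rfl⟩, fun x₀ u tmax x hu hmax => ?_⟩
  have htop := hmax.tmax_eq_top hd hu
  refine ⟨htop, fun t ht => ?_⟩
  have hx := norm_le_of_exp_decay hd hu hK hlam hc0 hexp hc hcB hmax.1 ht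
    (htop ▸ EReal.coe_lt_top t)
  simp only [id_eq]
  set I := ∫ s in (0 : ℝ)..t, ‖u s‖
  set a := K * ‖x₀‖ * Real.exp (-lam * t)
  set e := Real.exp (K * c * Real.exp (lam * Δ) * I)
  nlinarith [sq_nonneg (a - (e - 1))]

/-- A bilinear time-delay system is iISS if and only if `A` is Hurwitz. -/
theorem bilinear_iISS_iff_hurwitz
    (Δ : ℝ≥0) (n m p : ℕ)
    (A : Matrix (Fin n) (Fin n) ℝ)
    (Aij : Fin m → Fin p → Matrix (Fin n) (Fin n) ℝ)
    (B : Matrix (Fin n) (Fin m) ℝ)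
    (d : Fin p → ℝ) (hd : ∀ j, d j ∈ Icc (0 : ℝ) (Δ : ℝ)) :
    iISS Δ (fun (φ : Hist Δ n) (v : Vec m) =>
        Matrix.toEuclideanLin A (ev0 φ)
          + (∑ i : Fin m, ∑ j : Fin p, v i •
              Matrix.toEuclideanLin (Aij i j)
                (φ (projIcc (-(Δ : ℝ)) 0 (neg_nonpos.mpr Δ.coe_nonneg) (-(d j)))))
          + Matrix.toEuclideanLin B v)
      ↔ ∀ μ ∈ spectrum ℂ (A.map (algebraMap ℝ ℂ)), μ.re < 0 := by
  change iISS Δ (bilinearField Δ A Aij B d) ↔ _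
  exact ⟨fun h μ hμ => re_neg_of_iISS hd h hμ, fun h => iISS_of_hurwitz Aij B hd h⟩
end
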